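/- Let Λ be a right 4-Nakayama artin algebra and let M be a finitely generated indecomposable 4-factor serial right Λ-module which is local and not colocal. Then l(M) = 5, soc(M) = S1 ⊕ S2 is a direct sum of two simple submodules, and exactly one of the following holds: either rad(M) = N ⊕ S1, where N is a uniserial submodule of length 3 with soc(N) = S2; or rad(M) = N1 ⊕ N2, where N1 and N2 are uniserial submodules of length 2 with soc(N1) = S1 and soc(N2) = S2. -/

import Mathlib

/-! Basic definitions for (right) modules over a ring: radical, socle, length,
uniserial, local, indecomposable, `n`-factor serial, right `n`-Nakayama algebras,
Nakayama algebras and almost split sequences. -/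

universe u v w

section ModuleDefs

variable (A : Type v) [Ring A] (M : Type w) [AddCommGroup M] [Module A M]

/-- The composition length of a module, i.e. the Krull dimension of its submodule lattice. -/
noncomputable def moduleLength : WithBot ℕ∞ := Order.krullDim (Submodule A M)

/-- The radical of a module: the intersection of all its maximal submodules. -/
def moduleRad : Submodule A M := sInf {N : Submodule A M | IsCoatom N}

/-- The socle of a module: the sum of all its simple submodules. -/
def moduleSoc : Submodule A M := sSup {N : Submodule A M | IsAtom N}

variable {A M}

/-- The radical of a submodule `N`, viewed as a submodule of the ambient module. -/
def radOf (N : Submodule A M) : Submodule A M :=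
  Submodule.map N.subtype (moduleRad A ↥N)

/-- The socle of a submodule `N`, viewed as a submodule of the ambient module. -/
def socOf (N : Submodule A M) : Submodule A M :=
  Submodule.map N.subtype (moduleSoc A ↥N)

variable (A M)

/-- The iterated radical `rad^n(M)`, as a submodule of `M`. -/
def radPow : ℕ → Submodule A M
  | 0 => ⊤
  | n + 1 => radOf (radPow n)

/-- A module is uniserial if its submodules are totally ordered by inclusion. -/
def IsUniserialModule : Prop := ∀ N P : Submodule A M, N ≤ P ∨ P ≤ N

/-- A module is local if it has a unique maximal submodule. -/
def IsLocalModule : Prop := ∃! N : Submodule A M, IsCoatom N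

/-- A module is colocal if its socle is a simple submodule. -/
def IsColocalModule : Prop := IsAtom (moduleSoc A M)

/-- A module is indecomposable if it is nonzero and is not the direct sum of two
nonzero submodules. -/
def IsIndecModule : Prop :=
  Nontrivial M ∧ ∀ N P : Submodule A M, IsCompl N P → N = ⊥ ∨ P = ⊥

/-- The Loewy length of a module: the least `n` with `rad^n(M) = 0`. -/
noncomputable def loewyLength : ℕ := sInf {n : ℕ | radPow A M n = ⊥}

/-- A module `M` of length `l` is `n`-factor serial (`l ≥ n > 1`) if it is not uniserial,
`M/rad^{l-n}(M)` is uniserial and `M/rad^{l-n+1}(M)` is not uniserial. -/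
def IsNFactorSerial (n : ℕ) : Prop :=
  1 < n ∧ ¬ IsUniserialModule A M ∧
  ∃ l : ℕ, moduleLength A M = l ∧ n ≤ l ∧
    IsUniserialModule A (M ⧸ radPow A M (l - n)) ∧
    ¬ IsUniserialModule A (M ⧸ radPow A M (l - n + 1))

/-- `M` is `n`-factor serial, where `1`-factor serial means uniserial. -/
def IsFactorSerial (n : ℕ) : Prop :=
  (n = 1 ∧ IsUniserialModule A M) ∨ IsNFactorSerial A M n

end ModuleDefs

section AlgebraDefs

variable (Λ : Type u) [Ring Λ]

/-- A ring `Λ` is right `n`-Nakayama if every finitely generated indecomposable right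
`Λ`-module is `i`-factor serial for some `1 ≤ i ≤ n`, and there is at least one finitely
generated indecomposable `n`-factor serial right `Λ`-module.  Right `Λ`-modules are
realized as left `Λᵐᵒᵖ`-modules. -/
def IsRightNNakayama (n : ℕ) : Prop :=
  (∀ M : ModuleCat.{u} Λᵐᵒᵖ, Module.Finite Λᵐᵒᵖ M → IsIndecModule Λᵐᵒᵖ M →
      ∃ i, 1 ≤ i ∧ i ≤ n ∧ IsFactorSerial Λᵐᵒᵖ M i) ∧
  ∃ M : ModuleCat.{u} Λᵐᵒᵖ, Module.Finite Λᵐᵒᵖ M ∧ IsIndecModule Λᵐᵒᵖ M ∧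
    IsNFactorSerial Λᵐᵒᵖ M n

/-- A ring `Λ` is a Nakayama algebra if every finitely generated indecomposable projective
right `Λ`-module and every finitely generated indecomposable projective left `Λ`-module is
uniserial. -/
def IsNakayamaAlgebra : Prop :=
  (∀ M : ModuleCat.{u} Λᵐᵒᵖ, Module.Finite Λᵐᵒᵖ M → Module.Projective Λᵐᵒᵖ M →
      IsIndecModule Λᵐᵒᵖ M → IsUniserialModule Λᵐᵒᵖ M) ∧
  (∀ M : ModuleCat.{u} Λ, Module.Finite Λ M → Module.Projective Λ M →
      IsIndecModule Λ M → IsUniserialModule Λ M)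

end AlgebraDefs

section AlmostSplit

variable {A : Type v} [Ring A]

/-- A pair of maps `f : X → Y`, `g : Y → Z` is an almost split (Auslander-Reiten) sequence
if `0 → X → Y → Z → 0` is a non-split short exact sequence with `X` and `Z` indecomposable,
such that every homomorphism `V → Z` from a finitely generated module which is not a split
epimorphism factors through `g`. -/
def IsAlmostSplitSequence {X Y Z : Type w} [AddCommGroup X] [Module A X]
    [AddCommGroup Y] [Module A Y] [AddCommGroup Z] [Module A Z]
    (f : X →ₗ[A] Y) (g : Y →ₗ[A] Z) : Prop :=
  Function.Injective f ∧ Function.Surjective g ∧ LinearMap.range f = LinearMap.ker g ∧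
  (¬ ∃ s : Z →ₗ[A] Y, g ∘ₗ s = LinearMap.id) ∧
  IsIndecModule A X ∧ IsIndecModule A Z ∧
  ∀ V : ModuleCat.{w} A, Module.Finite A V →
    ∀ h : V →ₗ[A] Z, (¬ ∃ s : Z →ₗ[A] V, h ∘ₗ s = LinearMap.id) →
      ∃ k : V →ₗ[A] Y, g ∘ₗ k = h

end AlmostSplit

section Length

variable {S : Type*} [Ring S] {M N : Type*} [AddCommGroup M] [Module S M]
  [AddCommGroup N] [Module S N]

/-- The composition length as a natural number (meaningful for modules of finite length). -/
noncomputable def natLength (S M : Type*) [Ring S] [AddCommGroup M] [Module S M] : ℕ :=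
  (Module.length S M).toNat

lemma coe_natLength [IsArtinian S M] [IsNoetherian S M] :
    (natLength S M : ℕ∞) = Module.length S M :=
  ENat.natCast_toNat Module.length_ne_top

lemma moduleLength_eq_natLength [IsArtinian S M] [IsNoetherian S M] :
    moduleLength S M = (natLength S M : ℕ) := by
  rw [moduleLength, ← Module.coe_length, ← coe_natLength]
  rfl

lemma natLength_eq_of_equiv (e : M ≃ₗ[S] N) : natLength S M = natLength S N := by
  rw [natLength, natLength, e.length_eq]

lemma natLength_top : natLength S (⊤ : Submodule S M) = natLength S M :=
  natLength_eq_of_equiv Submodule.topEquiv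

lemma natLength_bot : natLength S (⊥ : Submodule S M) = 0 := by
  rw [natLength, Module.length_bot, ENat.toNat_zero]

lemma natLength_eq_zero [IsArtinian S M] [IsNoetherian S M] (h : natLength S M = 0) :
    Subsingleton M := by
  rw [← Module.length_eq_zero_iff (R := S), ← coe_natLength, h, Nat.cast_zero]

lemma natLength_of_isSimpleModule [IsSimpleModule S M] : natLength S M = 1 := by
  simp [natLength, Module.length_eq_one]

lemma natLength_add_quotient [IsArtinian S M] [IsNoetherian S M] (P : Submodule S M) :
    natLength S P + natLength S (M ⧸ P) = natLength S M := by
  have h := Module.length_eq_add_of_exact P.subtype P.mkQ P.subtype_injective P.mkQ_surjective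
    (LinearMap.exact_subtype_mkQ P)
  rw [← coe_natLength, ← coe_natLength, ← coe_natLength] at h
  exact_mod_cast h.symm

lemma natLength_prod [IsArtinian S M] [IsNoetherian S M] [IsArtinian S N] [IsNoetherian S N] :
    natLength S (M × N) = natLength S M + natLength S N := by
  have h := Module.length_prod (R := S) (M := M) (N := N)
  rw [← coe_natLength, ← coe_natLength, ← coe_natLength] at h
  exact_mod_cast h

lemma natLength_range_add_ker [IsArtinian S M] [IsNoetherian S M] (f : M →ₗ[S] N) :
    natLength S (LinearMap.ker f) + natLength S (LinearMap.range f) = natLength S M := by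
  rw [← natLength_add_quotient (LinearMap.ker f), natLength_eq_of_equiv f.quotKerEquivRange]

lemma natLength_comap_subtype {P Q : Submodule S M} (h : P ≤ Q) :
    natLength S (P.comap Q.subtype) = natLength S P :=
  natLength_eq_of_equiv (Submodule.comapSubtypeEquivOfLe h)

lemma natLength_map_subtype {Q : Submodule S M} (P : Submodule S Q) :
    natLength S (P.map Q.subtype) = natLength S P :=
  (natLength_eq_of_equiv (Q.equivSubtypeMap P)).symm

lemma natLength_isAtom {P : Submodule S M} (h : IsAtom P) : natLength S P = 1 :=
  have := isSimpleModule_iff_isAtom.mpr h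
  natLength_of_isSimpleModule

lemma exists_isAtom_le [IsArtinian S M] {P : Submodule S M} (h : P ≠ ⊥) :
    ∃ T ≤ P, IsAtom T := by
  obtain h' | ⟨T, hT, hle⟩ := IsAtomic.eq_bot_or_exists_atom_le P
  · exact absurd h' h
  · exact ⟨T, hle, hT⟩

variable [IsArtinian S M] [IsNoetherian S M]

lemma natLength_lt_of_ne_top {P : Submodule S M} (h : P ≠ ⊤) :
    natLength S P < natLength S M := by
  have := Submodule.length_lt h
  rw [← coe_natLength, ← coe_natLength] at this
  exact_mod_cast this

lemma natLength_lt {P Q : Submodule S M} (h : P < Q) : natLength S P < natLength S Q := by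
  rw [← natLength_comap_subtype h.le]
  refine natLength_lt_of_ne_top fun h' => h.not_ge ?_
  exact Submodule.comap_subtype_eq_top.mp h'

lemma natLength_le {P Q : Submodule S M} (h : P ≤ Q) : natLength S P ≤ natLength S Q := by
  rcases h.lt_or_eq with h | rfl
  · exact (natLength_lt h).le
  · rfl

lemma eq_of_natLength_le {P Q : Submodule S M} (h : P ≤ Q)
    (h' : natLength S Q ≤ natLength S P) : P = Q := by
  rcases h.lt_or_eq with h | rfl
  · exact absurd (natLength_lt h) (by omega)
  · rfl

lemma natLength_sup_add_inf (P Q : Submodule S M) :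
    natLength S ↥(P ⊔ Q) + natLength S ↥(P ⊓ Q) = natLength S P + natLength S Q := by
  have h1 := natLength_add_quotient ((P ⊓ Q).comap P.subtype)
  have h2 := natLength_add_quotient (Q.comap (P ⊔ Q).subtype)
  have h3 := natLength_eq_of_equiv (LinearMap.quotientInfEquivSupQuotient P Q)
  rw [← Submodule.comap_inf] at h3
  rw [natLength_comap_subtype inf_le_left] at h1
  rw [natLength_comap_subtype le_sup_right] at h2
  omega

lemma isAtom_of_natLength {P : Submodule S M} (h : natLength S P = 1) : IsAtom P := by
  refine ⟨fun h0 => ?_, fun Q hQ => ?_⟩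
  · rw [h0, natLength_bot] at h; omega
  · have := natLength_lt hQ
    by_contra hne
    have := natLength_lt (bot_lt_iff_ne_bot.mpr hne)
    omega

lemma natLength_covBy {P Q : Submodule S M} (h : P ⋖ Q) :
    natLength S Q = natLength S P + 1 := by
  have h1 := natLength_add_quotient (P.comap Q.subtype)
  rw [natLength_comap_subtype h.le] at h1
  have : IsSimpleModule S (Q ⧸ P.comap Q.subtype) := (covBy_iff_quot_is_simple h.le).mp h
  have h2 : natLength S (Q ⧸ P.comap Q.subtype) = 1 := natLength_of_isSimpleModule
  omega

lemma covBy_of_natLength {P Q : Submodule S M} (h : P ≤ Q)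
    (h' : natLength S Q = natLength S P + 1) : P ⋖ Q := by
  refine ⟨lt_of_le_of_ne h fun e => by rw [e] at h'; omega, fun C h1 h2 => ?_⟩
  have := natLength_lt h1
  have := natLength_lt h2
  omega

lemma natLength_isCoatom {P : Submodule S M} (h : IsCoatom P) :
    natLength S M = natLength S P + 1 := by
  rw [← natLength_top, natLength_covBy h.covBy_top]

end Length

section LocalTop

variable {S : Type*} [Ring S] {M N : Type*} [AddCommGroup M] [Module S M]
  [AddCommGroup N] [Module S N]

/-- The radical is the greatest proper submodule. -/
def HasLocalTop (S M : Type*) [Ring S] [AddCommGroup M] [Module S M] : Prop :=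
  Module.jacobson S M ≠ ⊤ ∧ ∀ P : Submodule S M, P ≠ ⊤ → P ≤ Module.jacobson S M

lemma HasLocalTop.isCoatom (h : HasLocalTop S M) : IsCoatom (Module.jacobson S M) :=
  ⟨h.1, fun P hP => by
    by_contra hne
    exact hP.not_ge (h.2 P hne)⟩

lemma jacobson_eq_of_forall_le {K : Submodule S M} (hK : K ≠ ⊤) (h : ∀ P ≠ ⊤, P ≤ K) :
    Module.jacobson S M = K := by
  have hco : IsCoatom K := ⟨hK, fun P hP => by
    by_contra hne
    exact hP.not_ge (h P hne)⟩
  refine le_antisymm (sInf_le hco) (le_sInf fun C hC => ?_)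
  have := h C hC.1
  rcases this.lt_or_eq with h' | h'
  · exact absurd (hC.2 K h') hK
  · exact h'.ge

lemma hasLocalTop_of_forall_le {K : Submodule S M} (hK : K ≠ ⊤) (h : ∀ P ≠ ⊤, P ≤ K) :
    HasLocalTop S M := by
  rw [HasLocalTop, jacobson_eq_of_forall_le hK h]
  exact ⟨hK, h⟩

lemma HasLocalTop.isLocalModule (h : HasLocalTop S M) : IsLocalModule S M := by
  refine ⟨_, h.isCoatom, fun C hC => ?_⟩
  rcases (h.2 C hC.1).lt_or_eq with h' | h'
  · exact absurd (hC.2 _ h') h.1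
  · exact h'

lemma hasLocalTop_of_isLocalModule [IsNoetherian S M] (h : IsLocalModule S M) :
    HasLocalTop S M := by
  obtain ⟨K, hK, hu⟩ := h
  refine hasLocalTop_of_forall_le hK.1 fun P hP => ?_
  obtain h' | ⟨C, hC, hle⟩ := IsCoatomic.eq_top_or_exists_le_coatom P
  · exact absurd h' hP
  · rwa [← hu C hC]

lemma HasLocalTop.map_surjective (h : HasLocalTop S M) [Nontrivial N] {f : M →ₗ[S] N}
    (hf : Function.Surjective f) :
    HasLocalTop S N ∧ Module.jacobson S N = (Module.jacobson S M).map f := by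
  have h1 : (Module.jacobson S M).map f ≠ ⊤ := fun h0 => by
    have hker : LinearMap.ker f ≤ Module.jacobson S M := h.2 _ fun h' => by
      rw [LinearMap.ker_eq_top] at h'
      obtain ⟨y, hy⟩ := exists_ne (0 : N)
      obtain ⟨x, rfl⟩ := hf y
      exact hy (by simp [h'])
    apply h.1
    rw [← Submodule.comap_map_eq_self hker, h0, Submodule.comap_top]
  have h2 : ∀ P : Submodule S N, P ≠ ⊤ → P ≤ (Module.jacobson S M).map f := fun P hP => by
    rw [← Submodule.map_comap_eq_of_surjective hf P]
    refine Submodule.map_mono (h.2 _ fun h' => hP ?_)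
    rw [← Submodule.map_comap_eq_of_surjective hf P, h', Submodule.map_top,
      LinearMap.range_eq_top.mpr hf]
  exact ⟨hasLocalTop_of_forall_le h1 h2, jacobson_eq_of_forall_le h1 h2⟩

lemma HasLocalTop.quotient (h : HasLocalTop S M) {P : Submodule S M} (hP : P ≠ ⊤) :
    HasLocalTop S (M ⧸ P) ∧ Module.jacobson S (M ⧸ P) = (Module.jacobson S M).map P.mkQ :=
  have := Submodule.Quotient.nontrivial_iff.mpr hP
  h.map_surjective P.mkQ_surjective

lemma HasLocalTop.natLength_eq [IsArtinian S M] [IsNoetherian S M] (h : HasLocalTop S M) :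
    natLength S M = natLength S (Module.jacobson S M) + 1 :=
  natLength_isCoatom h.isCoatom

lemma HasLocalTop.range_le (h : HasLocalTop S N) {g : M →ₗ[S] N}
    (hg : ¬ Function.Surjective g) : LinearMap.range g ≤ Module.jacobson S N :=
  h.2 _ fun h' => hg (LinearMap.range_eq_top.mp h')

lemma map_eq_zero_of_mem_jacobson
    (hN : Module.jacobson S (Module.jacobson S N) = ⊥) {g : M →ₗ[S] N}
    (hg : LinearMap.range g ≤ Module.jacobson S N) {x : M} (hx : x ∈ Module.jacobson S M) :
    g x = 0 := by
  let g' : M →ₗ[S] Module.jacobson S N := g.codRestrict _ fun x => hg ⟨x, rfl⟩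
  have := Module.le_comap_jacobson g' hx
  rw [hN] at this
  exact congrArg Subtype.val ((Submodule.mem_bot S).mp this)

lemma range_le_jacobson_of_range_le {L : Type*} [AddCommGroup L] [Module S L]
    {f : L →ₗ[S] M} (hf : LinearMap.range f ≤ Module.jacobson S M) (g : M →ₗ[S] N) :
    LinearMap.range (g ∘ₗ f) ≤ Module.jacobson S N := by
  rw [LinearMap.range_comp]
  exact (Submodule.map_mono hf).trans (Module.map_jacobson_le g)

/-- An endomorphism of a local module with semisimple radical cannot kill something nonzero
and fix a nonzero submodule of the radical. -/
lemma HasLocalTop.false_of_endomorphism [IsNoetherian S M] (h : HasLocalTop S M)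
    (hss : Module.jacobson S (Module.jacobson S M) = ⊥) {g : M →ₗ[S] M}
    {x y : M} (hx : x ≠ 0) (hgx : g x = 0)
    (hy : y ≠ 0) (hyr : y ∈ Module.jacobson S M) (hgy : g y = y) : False := by
  have hg : ¬ Function.Surjective g := fun hs => hx <|
    IsNoetherian.injective_of_surjective_endomorphism g hs (hgx.trans (map_zero g).symm)
  exact hy (hgy ▸ map_eq_zero_of_mem_jacobson hss (h.range_le hg) hyr)

end LocalTop

section Amalgam

variable {S : Type*} [Ring S] {A B : Type*} [AddCommGroup A] [Module S A]
  [AddCommGroup B] [Module S B]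

lemma prod_jacobson_le_of_isCoatom {C : Submodule S (A × B)} (hC : IsCoatom C) :
    (Module.jacobson S A).prod (Module.jacobson S B) ≤ C := by
  have h1 := Module.map_jacobson_le (LinearMap.inl S A B)
  have h2 := Module.map_jacobson_le (LinearMap.inr S A B)
  have hle : Module.jacobson S (A × B) ≤ C := sInf_le hC
  rintro ⟨a, b⟩ ⟨ha, hb⟩
  have := C.add_mem (hle (h1 ⟨a, ha, rfl⟩)) (hle (h2 ⟨b, hb, rfl⟩))
  simpa using this

variable [IsArtinian S A] [IsNoetherian S A] [IsArtinian S B] [IsNoetherian S B]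

lemma natLength_prod_jacobson (hA : HasLocalTop S A) (hB : HasLocalTop S B) :
    natLength S (A × B) =
      natLength S ((Module.jacobson S A).prod (Module.jacobson S B)) + 2 := by
  let f : A × B →ₗ[S] (A ⧸ Module.jacobson S A) × (B ⧸ Module.jacobson S B) :=
    (Module.jacobson S A).mkQ.prodMap (Module.jacobson S B).mkQ
  have hf : LinearMap.range f = ⊤ := by
    rw [LinearMap.range_prodMap, Submodule.range_mkQ, Submodule.range_mkQ, Submodule.prod_top]
  have hk : LinearMap.ker f = (Module.jacobson S A).prod (Module.jacobson S B) := by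
    rw [LinearMap.ker_prodMap, Submodule.ker_mkQ, Submodule.ker_mkQ]
  have h := natLength_range_add_ker f
  rw [hf, hk, natLength_top, natLength_prod] at h
  have := isSimpleModule_iff_isCoatom.mpr hA.isCoatom
  have := isSimpleModule_iff_isCoatom.mpr hB.isCoatom
  have h1 : natLength S (A ⧸ Module.jacobson S A) = 1 := natLength_of_isSimpleModule
  have h2 : natLength S (B ⧸ Module.jacobson S B) = 1 := natLength_of_isSimpleModule
  omega

lemma natLength_inf_of_isCoatom {M : Type*} [AddCommGroup M] [Module S M] [IsArtinian S M]
    [IsNoetherian S M] {C D : Submodule S M} (hC : IsCoatom C) (hD : IsCoatom D) (h : C ≠ D) :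
    natLength S M = natLength S ↥(C ⊓ D) + 2 := by
  have h1 : C ⊔ D = ⊤ := hC.sup_eq_top_of_ne hD h
  have h2 := natLength_sup_add_inf C D
  rw [h1, natLength_top] at h2
  have := natLength_isCoatom hC
  have := natLength_isCoatom hD
  omega

lemma surjective_mkQ_comp_of_not_le {L M : Type*} [AddCommGroup M] [Module S M]
    [IsNoetherian S M] [AddCommGroup L] [Module S L] {f : L →ₗ[S] M} {P C : Submodule S M}
    (hC : ∀ C', IsCoatom C' → P ≤ C' → C' = C) (h : ¬ LinearMap.range f ≤ C) :
    Function.Surjective (P.mkQ ∘ₗ f) := by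
  rw [← LinearMap.range_eq_top, LinearMap.range_comp, Submodule.map_mkQ_eq_top]
  obtain h' | ⟨C', hC', hle⟩ := IsCoatomic.eq_top_or_exists_le_coatom (P ⊔ LinearMap.range f)
  · exact h'
  · exact absurd (hC C' hC' (le_sup_left.trans hle) ▸ le_sup_right.trans hle) h

lemma surjective_components_of_sup_eq_top (hA : HasLocalTop S A) (hB : HasLocalTop S B)
    {P N : Submodule S (A × B)} (hP : P ≠ ⊤) (hN : N ≠ ⊤) (h : P ⊔ N = ⊤) :
    (Function.Surjective (P.mkQ ∘ₗ LinearMap.inl S A B) ∧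
      Function.Surjective (N.mkQ ∘ₗ LinearMap.inr S A B)) ∨
    (Function.Surjective (P.mkQ ∘ₗ LinearMap.inr S A B) ∧
      Function.Surjective (N.mkQ ∘ₗ LinearMap.inl S A B)) := by
  have hW := natLength_prod_jacobson hA hB
  set W := (Module.jacobson S A).prod (Module.jacobson S B) with hWdef
  have inf_eq : ∀ {C D : Submodule S (A × B)}, IsCoatom C → IsCoatom D → C ≠ D →
      W = C ⊓ D := fun {C D} hC hD hne => by
    refine eq_of_natLength_le
      (le_inf (prod_jacobson_le_of_isCoatom hC) (prod_jacobson_le_of_isCoatom hD)) ?_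
    have := natLength_inf_of_isCoatom hC hD hne
    omega
  have uniq : ∀ {P N : Submodule S (A × B)}, P ⊔ N = ⊤ → N ≠ ⊤ → ∀ C C', IsCoatom C →
      IsCoatom C' → P ≤ C → P ≤ C' → C' = C := by
    intro P N hPN hN C C' hC hC' hPC hPC'
    by_contra hne
    obtain h' | ⟨D, hD, hND⟩ := IsCoatomic.eq_top_or_exists_le_coatom N
    · exact hN h'
    have hPD : P ≤ D := by
      refine le_trans ?_ (prod_jacobson_le_of_isCoatom hD)
      rw [← hWdef, inf_eq hC' hC hne]
      exact le_inf hPC' hPC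
    exact hD.1 (top_le_iff.mp (hPN ▸ sup_le hPD hND))
  obtain h' | ⟨C, hC, hPC⟩ := IsCoatomic.eq_top_or_exists_le_coatom P
  · exact absurd h' hP
  obtain h' | ⟨D, hD, hND⟩ := IsCoatomic.eq_top_or_exists_le_coatom N
  · exact absurd h' hN
  have hCD : C ≠ D := by
    rintro rfl
    exact hC.1 (top_le_iff.mp (h ▸ sup_le hPC hND))
  have hC' := fun C' h1 h2 => uniq h hN C C' hC h1 hPC h2
  have hD' := fun D' h1 h2 => uniq (sup_comm P N ▸ h) hP D D' hD h1 hND h2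
  have htop : LinearMap.range (LinearMap.inl S A B) ⊔ LinearMap.range (LinearMap.inr S A B) = ⊤ :=
    LinearMap.sup_range_inl_inr
  have hCab : LinearMap.range (LinearMap.inl S A B) ≤ C →
      ¬ LinearMap.range (LinearMap.inr S A B) ≤ C := fun h1 h2 =>
    hC.1 (top_le_iff.mp (htop ▸ sup_le h1 h2))
  have hDab : LinearMap.range (LinearMap.inl S A B) ≤ D →
      ¬ LinearMap.range (LinearMap.inr S A B) ≤ D := fun h1 h2 =>
    hD.1 (top_le_iff.mp (htop ▸ sup_le h1 h2))
  have ha : LinearMap.range (LinearMap.inl S A B) ≤ C →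
      ¬ LinearMap.range (LinearMap.inl S A B) ≤ D := fun h1 h2 => by
    apply hA.1
    rw [eq_top_iff]
    intro a _
    have : LinearMap.inl S A B a ∈ W := by
      rw [inf_eq hC hD hCD]
      exact ⟨h1 ⟨a, rfl⟩, h2 ⟨a, rfl⟩⟩
    exact this.1
  have hb : LinearMap.range (LinearMap.inr S A B) ≤ C →
      ¬ LinearMap.range (LinearMap.inr S A B) ≤ D := fun h1 h2 => by
    apply hB.1
    rw [eq_top_iff]
    intro b _
    have : LinearMap.inr S A B b ∈ W := by
      rw [inf_eq hC hD hCD]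
      exact ⟨h1 ⟨b, rfl⟩, h2 ⟨b, rfl⟩⟩
    exact this.2
  by_cases h1 : LinearMap.range (LinearMap.inl S A B) ≤ C
  · exact .inr ⟨surjective_mkQ_comp_of_not_le hC' (hCab h1),
      surjective_mkQ_comp_of_not_le hD' (ha h1)⟩
  · by_cases h2 : LinearMap.range (LinearMap.inr S A B) ≤ D
    · exact .inr ⟨surjective_mkQ_comp_of_not_le hC' fun h3 => hb h3 h2,
        surjective_mkQ_comp_of_not_le hD' fun h3 => hDab h3 h2⟩
    · exact .inl ⟨surjective_mkQ_comp_of_not_le hC' h1, surjective_mkQ_comp_of_not_le hD' h2⟩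

/-- If an amalgamated sum of two local modules along a simple module decomposes, then one of
the two inclusions of the simple module extends along the other. -/
lemma exists_extension_of_decomposition (hA : HasLocalTop S A) (hB : HasLocalTop S B)
    {T : Type*} [AddCommGroup T] [Module S T] [IsSimpleModule S T]
    {f : T →ₗ[S] A} {g : T →ₗ[S] B} (hf : Function.Injective f)
    {P N : Submodule S (A × B)} (hP : P ≠ ⊤) (hN : N ≠ ⊤) (hsup : P ⊔ N = ⊤)
    (hinf : P ⊓ N = LinearMap.range (f.prod (-g))) :
    (∃ h : A →ₗ[S] B, h ∘ₗ f = g) ∨ ∃ h : B →ₗ[S] A, h ∘ₗ g = f := by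
  have hG : natLength S ↥(P ⊓ N) = 1 := by
    have hinj : Function.Injective (f.prod (-g)) := fun x y hxy =>
      hf (congrArg Prod.fst hxy)
    rw [hinf, ← natLength_eq_of_equiv (LinearEquiv.ofInjective _ hinj),
      natLength_of_isSimpleModule]
  have hglue : ∀ {Q : Submodule S (A × B)}, P ⊓ N ≤ Q → ∀ t,
      (Q.mkQ ∘ₗ LinearMap.inl S A B) (f t) = (Q.mkQ ∘ₗ LinearMap.inr S A B) (g t) := by
    intro Q hQ t
    refine (Submodule.Quotient.eq _).mpr (hQ ?_)
    rw [hinf]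
    exact ⟨t, by simp⟩
  have hlen := natLength_sup_add_inf P N
  rw [hsup, hG, natLength_top, natLength_prod] at hlen
  have hqP := natLength_add_quotient P
  have hqN := natLength_add_quotient N
  rw [natLength_prod] at hqP hqN
  have key : ∀ {P N : Submodule S (A × B)}, (∀ t,
      (P.mkQ ∘ₗ LinearMap.inl S A B) (f t) = (P.mkQ ∘ₗ LinearMap.inr S A B) (g t)) → (∀ t,
      (N.mkQ ∘ₗ LinearMap.inl S A B) (f t) = (N.mkQ ∘ₗ LinearMap.inr S A B) (g t)) →
      natLength S A + natLength S B ≤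
        natLength S ((A × B) ⧸ P) + natLength S ((A × B) ⧸ N) + 1 →
      Function.Surjective (P.mkQ ∘ₗ LinearMap.inl S A B) →
      Function.Surjective (N.mkQ ∘ₗ LinearMap.inr S A B) →
      (∃ h : A →ₗ[S] B, h ∘ₗ f = g) ∨ ∃ h : B →ₗ[S] A, h ∘ₗ g = f := by
    intro P N hgP hgN hle hsP hsN
    set p := P.mkQ ∘ₗ LinearMap.inl S A B
    set q := N.mkQ ∘ₗ LinearMap.inr S A B
    have h1 := natLength_range_add_ker p
    have h2 := natLength_range_add_ker q
    rw [LinearMap.range_eq_top.mpr hsP, natLength_top] at h1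
    rw [LinearMap.range_eq_top.mpr hsN, natLength_top] at h2
    rcases Nat.eq_zero_or_pos (natLength S (LinearMap.ker p)) with h0 | h0
    · right
      have hb : Function.Bijective p := ⟨LinearMap.ker_eq_bot.mp
        (Submodule.subsingleton_iff_eq_bot.mp (natLength_eq_zero h0)), hsP⟩
      let e := LinearEquiv.ofBijective p hb
      refine ⟨e.symm.toLinearMap ∘ₗ P.mkQ ∘ₗ LinearMap.inr S A B, LinearMap.ext fun t => ?_⟩
      have := hgP t
      simp only [LinearMap.comp_apply] at this ⊢
      rw [← this]
      exact e.symm_apply_apply (f t)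
    · left
      have h0' : natLength S (LinearMap.ker q) = 0 := by omega
      have hb : Function.Bijective q := ⟨LinearMap.ker_eq_bot.mp
        (Submodule.subsingleton_iff_eq_bot.mp (natLength_eq_zero h0')), hsN⟩
      let e := LinearEquiv.ofBijective q hb
      refine ⟨e.symm.toLinearMap ∘ₗ N.mkQ ∘ₗ LinearMap.inl S A B, LinearMap.ext fun t => ?_⟩
      have := hgN t
      simp only [LinearMap.comp_apply] at this ⊢
      rw [this]
      exact e.symm_apply_apply (g t)
  rcases surjective_components_of_sup_eq_top hA hB hP hN hsup with ⟨h1, h2⟩ | ⟨h1, h2⟩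
  · exact key (hglue inf_le_left) (hglue inf_le_right) (by omega) h1 h2
  · exact key (hglue inf_le_right) (hglue inf_le_left) (by omega) h2 h1

end Amalgam

section LongIndecomposables

/-- Every indecomposable module of length at least five is local. -/
def LongIndecLocal (S : Type u) [Ring S] : Prop :=
  ∀ (X : Type u) [AddCommGroup X] [Module S X], Module.Finite S X → IsIndecModule S X →
    5 ≤ natLength S X → IsLocalModule S X

variable {S : Type u} [Ring S] {A B : Type u} [AddCommGroup A] [Module S A]
  [AddCommGroup B] [Module S B]
variable [IsArtinian S A] [IsNoetherian S A] [IsArtinian S B] [IsNoetherian S B]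

lemma LongIndecLocal.exists_extension (hS : LongIndecLocal S)
    (hA : HasLocalTop S A) (hB : HasLocalTop S B) (hlen : 6 ≤ natLength S A + natLength S B)
    {T : Type*} [AddCommGroup T] [Module S T] [IsSimpleModule S T]
    {f : T →ₗ[S] A} {g : T →ₗ[S] B} (hf : Function.Injective f)
    (hfr : LinearMap.range f ≤ Module.jacobson S A)
    (hgr : LinearMap.range g ≤ Module.jacobson S B) :
    (∃ h : A →ₗ[S] B, h ∘ₗ f = g) ∨ ∃ h : B →ₗ[S] A, h ∘ₗ g = f := by
  set G := LinearMap.range (f.prod (-g)) with hG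
  have hG1 : natLength S G = 1 := by
    have hinj : Function.Injective (f.prod (-g)) := fun x y hxy =>
      hf (congrArg Prod.fst hxy)
    rw [hG, ← natLength_eq_of_equiv (LinearEquiv.ofInjective _ hinj),
      natLength_of_isSimpleModule]
  have hGle : G ≤ (Module.jacobson S A).prod (Module.jacobson S B) := by
    rintro _ ⟨t, rfl⟩
    exact ⟨hfr ⟨t, rfl⟩, neg_mem (hgr ⟨t, rfl⟩)⟩
  have hX := natLength_add_quotient G
  rw [natLength_prod] at hX
  have hnl : ¬ IsLocalModule S ((A × B) ⧸ G) := by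
    intro hloc
    have hloc := hasLocalTop_of_isLocalModule hloc
    have e1 : (Module.jacobson S A).prod ⊤ ≠ (⊤ : Submodule S (A × B)) := fun h0 => hA.1 <|
      eq_top_iff.mpr fun a _ => by
        have : (a, (0 : B)) ∈ (Module.jacobson S A).prod ⊤ := h0 ▸ Submodule.mem_top
        exact this.1
    have e2 : Submodule.prod ⊤ (Module.jacobson S B) ≠ (⊤ : Submodule S (A × B)) :=
      fun h0 => hB.1 <| eq_top_iff.mpr fun b _ => by
        have : ((0 : A), b) ∈ Submodule.prod ⊤ (Module.jacobson S B) := h0 ▸ Submodule.mem_top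
        exact this.2
    have key : ∀ Q : Submodule S (A × B), G ≤ Q → Q ≠ ⊤ →
        Q ≤ (Module.jacobson S ((A × B) ⧸ G)).comap G.mkQ := fun Q hGQ hQ => by
      rw [← Submodule.map_le_iff_le_comap]
      refine hloc.2 _ fun h0 => hQ ?_
      rw [Submodule.map_mkQ_eq_top, sup_eq_right.mpr hGQ] at h0
      exact h0
    have h1 := key _ (hGle.trans (Submodule.prod_mono le_rfl le_top)) e1
    have h2 := key _ (hGle.trans (Submodule.prod_mono le_top le_rfl)) e2
    apply hloc.1
    rw [eq_top_iff]
    intro x _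
    obtain ⟨⟨a, b⟩, rfl⟩ := G.mkQ_surjective x
    have := Submodule.add_mem _
      (h2 (show (a, (0 : B)) ∈ _ from ⟨trivial, zero_mem _⟩))
      (h1 (show ((0 : A), b) ∈ _ from ⟨zero_mem _, trivial⟩))
    simpa using this
  have hdec : ¬ IsIndecModule S ((A × B) ⧸ G) := fun hi =>
    hnl (hS _ inferInstance hi (by omega))
  have hnt : Nontrivial ((A × B) ⧸ G) := by
    by_contra hn
    rw [not_nontrivial_iff_subsingleton] at hn
    have : natLength S ((A × B) ⧸ G) = 0 := by
      rw [natLength, Module.length_eq_zero, ENat.toNat_zero]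
    omega
  simp only [IsIndecModule, hnt, true_and, not_forall, not_or] at hdec
  obtain ⟨N, P, hc, hN, hP⟩ := hdec
  have hne : ∀ {N P : Submodule S ((A × B) ⧸ G)}, IsCompl N P → P ≠ ⊥ →
      N.comap G.mkQ ≠ ⊤ := fun {N P} hc hP h0 => hP <| by
    have hN : N = ⊤ := by
      rw [← Submodule.map_comap_eq_of_surjective G.mkQ_surjective N, h0, Submodule.map_top,
        Submodule.range_mkQ]
    simpa [hN] using hc.inf_eq_bot
  refine exists_extension_of_decomposition hA hB hf (hne hc hP) (hne hc.symm hN) ?_ ?_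
  · refine eq_top_iff.mpr fun x _ => ?_
    have hx : G.mkQ x ∈ N ⊔ P := hc.sup_eq_top ▸ Submodule.mem_top
    obtain ⟨y, hy, z, hz, hyz⟩ := Submodule.mem_sup.mp hx
    obtain ⟨y, rfl⟩ := G.mkQ_surjective y
    have : x = y + (x - y) := by abel
    rw [this]
    refine Submodule.add_mem_sup hy ?_
    rw [Submodule.mem_comap, map_sub, ← hyz, add_sub_cancel_left]
    exact hz
  · rw [← Submodule.comap_inf, hc.inf_eq_bot]
    exact G.ker_mkQ

end LongIndecomposables

section Extension

variable {S : Type u} [Ring S]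

lemma bijective_of_surjective_of_natLength {M N : Type*} [AddCommGroup M] [Module S M]
    [AddCommGroup N] [Module S N] [IsArtinian S M] [IsNoetherian S M]
    (h : natLength S M ≤ natLength S N) {f : M →ₗ[S] N} (hf : Function.Surjective f) :
    Function.Bijective f := by
  refine ⟨?_, hf⟩
  have h1 := natLength_range_add_ker f
  rw [LinearMap.range_eq_top.mpr hf, natLength_top] at h1
  exact LinearMap.ker_eq_bot.mp
    (Submodule.subsingleton_iff_eq_bot.mp (natLength_eq_zero (S := S) (by omega)))

variable {Z Y : Type u} [AddCommGroup Z] [Module S Z]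
  [AddCommGroup Y] [Module S Y]
variable [IsArtinian S Z] [IsNoetherian S Z] [IsArtinian S Y] [IsNoetherian S Y]

lemma natLength_sup_of_isAtom {c d : Submodule S Y} (hc : IsAtom c) (hd : IsAtom d)
    (h : c ≠ d) : natLength S ↥(c ⊔ d) = 2 := by
  have h1 := natLength_sup_add_inf c d
  rw [(hc.disjoint_of_ne hd h).eq_bot, natLength_bot, natLength_isAtom hc, natLength_isAtom hd] at h1
  omega

/-- If a local module `Y` with radical `c ⊕ d` embeds in the radical of a local module `Z`,
then the embedding of `d` extends along `d → Y / c`. -/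
lemma LongIndecLocal.exists_hom_of_jacobson_eq_sup (hS : LongIndecLocal S)
    (hZ : HasLocalTop S Z) (hY : HasLocalTop S Y) (hlen : 4 ≤ natLength S Z)
    {i : Y →ₗ[S] Z} (hi : Function.Injective i)
    (hir : LinearMap.range i ≤ Module.jacobson S Z) {c d : Submodule S Y}
    (hc : IsAtom c) (hd : IsAtom d) (hcd : c ≠ d) (hY2 : Module.jacobson S Y = c ⊔ d) :
    ∃ h : Y →ₗ[S] Z, (∀ x ∈ c, h x = 0) ∧ ∀ x ∈ d, h x = i x := by
  have hlY := hY.natLength_eq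
  rw [hY2, natLength_sup_of_isAtom hc hd hcd] at hlY
  have hcT : c ≠ ⊤ := fun h0 => by
    have := natLength_isAtom hc
    rw [h0, natLength_top] at this
    omega
  obtain ⟨hB, hBj⟩ := hY.quotient hcT
  have hlB := natLength_add_quotient c
  rw [natLength_isAtom hc] at hlB
  have := isSimpleModule_iff_isAtom.mpr hd
  have hBs : IsSimpleModule S (Module.jacobson S (Y ⧸ c)) := by
    rw [isSimpleModule_iff_isAtom]
    apply isAtom_of_natLength
    have := hB.natLength_eq
    omega
  rcases hS.exists_extension hZ hB (by omega) (f := i ∘ₗ d.subtype) (g := c.mkQ ∘ₗ d.subtype)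
    (hi.comp d.subtype_injective) (by
      rintro _ ⟨x, rfl⟩
      exact hir ⟨_, rfl⟩) (by
      rintro _ ⟨x, rfl⟩
      rw [hBj, hY2]
      exact ⟨x, le_sup_right (a := c) x.2, rfl⟩) with ⟨h, hh⟩ | ⟨h, hh⟩
  · refine absurd ?_ hcd
    have hdc : d ≤ c := fun x hx => by
      have h1 := map_eq_zero_of_mem_jacobson (x := x) (IsSimpleModule.jacobson_eq_bot S _)
        (range_le_jacobson_of_range_le hir h) (hY2 ▸ le_sup_right (a := c) hx)
      have h2 := LinearMap.congr_fun hh ⟨x, hx⟩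
      simp only [LinearMap.comp_apply, Submodule.subtype_apply] at h1 h2
      rw [h1] at h2
      exact (Submodule.Quotient.mk_eq_zero c).mp h2.symm
    exact ((hc.le_iff_eq hd.1).mp hdc).symm
  · refine ⟨h ∘ₗ c.mkQ, fun x hx => ?_, fun x hx => LinearMap.congr_fun hh ⟨x, hx⟩⟩
    have : c.mkQ x = 0 := (Submodule.Quotient.mk_eq_zero c).mpr hx
    rw [LinearMap.comp_apply, this, map_zero]

lemma LongIndecLocal.exists_hom_bijective (hS : LongIndecLocal S)
    (hZ : HasLocalTop S Z) (hY : HasLocalTop S Y)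
    (hZ2 : Module.jacobson S (Module.jacobson S Z) = ⊥)
    (hY2 : Module.jacobson S (Module.jacobson S Y) = ⊥)
    (hlen : 3 ≤ natLength S Z) (heq : natLength S Z = natLength S Y)
    {T : Type*} [AddCommGroup T] [Module S T] [IsSimpleModule S T]
    {f : T →ₗ[S] Z} {g : T →ₗ[S] Y} (hf : Function.Injective f) (hg : Function.Injective g)
    (hfr : LinearMap.range f ≤ Module.jacobson S Z)
    (hgr : LinearMap.range g ≤ Module.jacobson S Y) :
    ∃ h : Z →ₗ[S] Y, Function.Bijective h ∧ h ∘ₗ f = g := by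
  have := IsSimpleModule.nontrivial S T
  obtain ⟨t, ht⟩ := exists_ne (0 : T)
  rcases hS.exists_extension hZ hY (by omega) hf hfr hgr with ⟨h, hh⟩ | ⟨h, hh⟩
  · have hs : Function.Surjective h := by
      by_contra hns
      have h1 := map_eq_zero_of_mem_jacobson hY2 (hY.range_le hns) (hfr ⟨t, rfl⟩)
      have h2 := LinearMap.congr_fun hh t
      rw [LinearMap.comp_apply, h1] at h2
      exact ht (hg (h2.symm.trans (map_zero g).symm))
    exact ⟨h, bijective_of_surjective_of_natLength heq.le hs, hh⟩
  · have hs : Function.Surjective h := by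
      by_contra hns
      have h1 := map_eq_zero_of_mem_jacobson hZ2 (hZ.range_le hns) (hgr ⟨t, rfl⟩)
      have h2 := LinearMap.congr_fun hh t
      rw [LinearMap.comp_apply, h1] at h2
      exact ht (hf (h2.symm.trans (map_zero f).symm))
    let e := LinearEquiv.ofBijective h (bijective_of_surjective_of_natLength heq.ge hs)
    refine ⟨e.symm, e.symm.bijective, LinearMap.ext fun t => ?_⟩
    rw [← hh]
    exact e.symm_apply_apply (g t)

/-- A local module with semisimple radical. -/
def IsLocalSemisimpleRad (S M : Type*) [Ring S] [AddCommGroup M] [Module S M] : Prop :=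
  HasLocalTop S M ∧ Module.jacobson S (Module.jacobson S M) = ⊥

/-- Homomorphisms between quotients of a local module with semisimple radical of maximal length
lift to endomorphisms. -/
lemma exists_lift_of_maximal_natLength (hZ : IsLocalSemisimpleRad S Z)
    (hmax : ∀ (X : Type u) [AddCommGroup X] [Module S X], Module.Finite S X →
      IsLocalSemisimpleRad S X → natLength S X ≤ natLength S Z)
    {V W : Submodule S Z} (α : (Z ⧸ V) →ₗ[S] (Z ⧸ W)) :
    ∃ e : Z →ₗ[S] Z, W.mkQ ∘ₗ e = α ∘ₗ V.mkQ := by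
  let G : Submodule S (Z × Z) :=
    LinearMap.eqLocus (W.mkQ ∘ₗ LinearMap.snd S Z Z) (α ∘ₗ V.mkQ ∘ₗ LinearMap.fst S Z Z)
  have hG : G.map (LinearMap.fst S Z Z) = ⊤ := by
    rw [eq_top_iff]
    intro x _
    obtain ⟨y, hy⟩ := W.mkQ_surjective (α (V.mkQ x))
    exact ⟨(x, y), hy, rfl⟩
  obtain ⟨Q, ⟨hQG, hQ⟩, hmin⟩ := WellFounded.has_min (wellFounded_lt (α := Submodule S (Z × Z)))
    {Q | Q ≤ G ∧ Q.map (LinearMap.fst S Z Z) = ⊤} ⟨G, le_rfl, hG⟩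
  let p : Q →ₗ[S] Z := LinearMap.fst S Z Z ∘ₗ Q.subtype
  let q : Q →ₗ[S] Z := LinearMap.snd S Z Z ∘ₗ Q.subtype
  have hp : Function.Surjective p := by
    rw [← LinearMap.range_eq_top, LinearMap.range_comp, Submodule.range_subtype, hQ]
  have hK : (Module.jacobson S Z).comap p ≠ ⊤ := fun h0 => hZ.1.1 <| by
    rw [← Submodule.map_comap_eq_of_surjective hp (Module.jacobson S Z), h0, Submodule.map_top,
      LinearMap.range_eq_top.mpr hp]
  have hK' : ∀ P : Submodule S Q, P ≠ ⊤ → P ≤ (Module.jacobson S Z).comap p := by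
    intro P hP
    rw [← Submodule.map_le_iff_le_comap]
    refine hZ.1.2 _ fun h0 => hP ?_
    have h1 : P.map Q.subtype ≤ Q := Submodule.map_subtype_le Q P
    have h2 : ¬ P.map Q.subtype < Q := hmin _ ⟨h1.trans hQG, by rw [← Submodule.map_comp, h0]⟩
    have h3 : P.map Q.subtype = Q := h1.eq_of_not_lt h2
    rw [eq_top_iff]
    rintro ⟨x, hx⟩ _
    rw [← h3] at hx
    obtain ⟨y, hy, rfl⟩ := hx
    exact hy
  have hQl : IsLocalSemisimpleRad S Q := by
    refine ⟨hasLocalTop_of_forall_le hK hK', ?_⟩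
    have hpj := Module.le_comap_jacobson p
    have hqj := Module.le_comap_jacobson q
    let p' : Module.jacobson S Q →ₗ[S] Module.jacobson S Z := p.restrict hpj
    let q' : Module.jacobson S Q →ₗ[S] Module.jacobson S Z := q.restrict hqj
    rw [eq_bot_iff]
    intro x hx
    have h1 := Module.le_comap_jacobson p' hx
    have h2 := Module.le_comap_jacobson q' hx
    rw [hZ.2] at h1 h2
    rw [Submodule.mem_bot]
    exact Subtype.ext (Subtype.ext (Prod.ext (congrArg Subtype.val ((Submodule.mem_bot S).mp h1))
      (congrArg Subtype.val ((Submodule.mem_bot S).mp h2))))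
  let e := LinearEquiv.ofBijective p
    (bijective_of_surjective_of_natLength (hmax Q inferInstance hQl) hp)
  refine ⟨q ∘ₗ e.symm, LinearMap.ext fun x => ?_⟩
  have h1 : (e.symm x : Z × Z) ∈ G := hQG (e.symm x).2
  have h2 : (e.symm x : Z × Z).1 = x := e.apply_symm_apply x
  have h3 : W.mkQ (e.symm x : Z × Z).2 = α (V.mkQ (e.symm x : Z × Z).1) := h1
  rw [h2] at h3
  exact h3

end Extension

section SemisimpleRadical

variable {S : Type u} [Ring S] {Q : Type u} [AddCommGroup Q] [Module S Q]

lemma mkQ_comp_subtype_injective {V T : Submodule S Q} (h : Disjoint V T) :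
    Function.Injective (V.mkQ ∘ₗ T.subtype) := by
  rw [← LinearMap.ker_eq_bot, LinearMap.ker_comp, Submodule.ker_mkQ, eq_bot_iff]
  intro x hx
  exact Subtype.ext (Submodule.disjoint_def.mp h x hx x.2)

lemma IsLocalSemisimpleRad.range_mkQ_comp_subtype_le (hQ : IsLocalSemisimpleRad S Q)
    {V T : Submodule S Q} (hV : V ≠ ⊤) (hT : T ≤ Module.jacobson S Q) :
    LinearMap.range (V.mkQ ∘ₗ T.subtype) ≤ Module.jacobson S (Q ⧸ V) := by
  rintro _ ⟨x, rfl⟩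
  rw [(hQ.1.quotient hV).2]
  exact ⟨x, hT x.2, rfl⟩

lemma IsAtom.ne_top_of_natLength {V : Submodule S Q} (hV : IsAtom V) (hlen : 4 ≤ natLength S Q) :
    V ≠ ⊤ := fun h0 => by
  have := natLength_isAtom hV
  rw [h0, natLength_top] at this
  omega

lemma IsLocalSemisimpleRad.quotient [IsArtinian S Q] (hQ : IsLocalSemisimpleRad S Q)
    {V : Submodule S Q} (hV : V ≠ ⊤) : IsLocalSemisimpleRad S (Q ⧸ V) := by
  obtain ⟨h1, h2⟩ := hQ.1.quotient hV
  refine ⟨h1, ?_⟩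
  have := (IsArtinian.isSemisimpleModule_iff_jacobson S (Module.jacobson S Q)).mpr hQ.2
  have h3 : ∀ x ∈ Module.jacobson S Q, V.mkQ x ∈ Module.jacobson S (Q ⧸ V) := fun x hx => by
    rw [h2]
    exact ⟨x, hx, rfl⟩
  have h4 : Function.Surjective (V.mkQ.restrict h3) := by
    rintro ⟨y, hy⟩
    rw [h2] at hy
    obtain ⟨x, hx, rfl⟩ := hy
    exact ⟨⟨x, hx⟩, rfl⟩
  have := IsSemisimpleModule.of_surjective _ h4
  exact IsSemisimpleModule.jacobson_eq_bot S _

variable [IsArtinian S Q] [IsNoetherian S Q]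

lemma exists_isAtom_disjoint {J N : Submodule S Q} (hJ : Module.jacobson S J = ⊥) (hN : N ≤ J)
    (hne : N ≠ J) : ∃ T ≤ J, IsAtom T ∧ Disjoint N T := by
  have : IsSemisimpleModule S J := (IsArtinian.isSemisimpleModule_iff_jacobson S J).mpr hJ
  obtain ⟨P, hP⟩ := exists_isCompl (N.comap J.subtype)
  have hPb : P ≠ ⊥ := fun h0 => by
    have h1 := hP.sup_eq_top
    rw [h0, sup_bot_eq, Submodule.comap_subtype_eq_top] at h1
    exact hne (le_antisymm hN h1)
  obtain ⟨T, hTP, hT⟩ := exists_isAtom_le hPb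
  refine ⟨T.map J.subtype, Submodule.map_subtype_le J T,
    isAtom_of_natLength ((natLength_map_subtype T).trans (natLength_isAtom hT)), ?_⟩
  rw [Submodule.disjoint_def]
  rintro _ hx ⟨y, hy, rfl⟩
  have := Submodule.disjoint_def.mp hP.disjoint y hx (hTP hy)
  rw [this, map_zero]

/-- A local module with semisimple radical of maximal length among those. -/
def IsMaximalLocalSemisimpleRad (S Q : Type u) [Ring S] [AddCommGroup Q] [Module S Q] : Prop :=
  IsLocalSemisimpleRad S Q ∧ ∀ (X : Type u) [AddCommGroup X] [Module S X], Module.Finite S X →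
    IsLocalSemisimpleRad S X → natLength S X ≤ natLength S Q

lemma IsMaximalLocalSemisimpleRad.exists_endomorphism (hS : LongIndecLocal S)
    (hQ : IsMaximalLocalSemisimpleRad S Q) (hlen : 4 ≤ natLength S Q)
    {V W : Submodule S Q} (hV : IsAtom V) (hW : IsAtom W)
    {T : Type*} [AddCommGroup T] [Module S T] [IsSimpleModule S T]
    {f : T →ₗ[S] Q ⧸ V} {g : T →ₗ[S] Q ⧸ W} (hf : Function.Injective f)
    (hg : Function.Injective g)
    (hfr : LinearMap.range f ≤ Module.jacobson S (Q ⧸ V))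
    (hgr : LinearMap.range g ≤ Module.jacobson S (Q ⧸ W)) :
    ∃ e : Q →ₗ[S] Q, Function.Injective e ∧ (∀ x ∈ V, e x ∈ W) ∧
      ∀ x t, V.mkQ x = f t → W.mkQ (e x) = g t := by
  have hVt := hV.ne_top_of_natLength hlen
  have hWt := hW.ne_top_of_natLength hlen
  have hlV := natLength_add_quotient V
  have hlW := natLength_add_quotient W
  rw [natLength_isAtom hV] at hlV
  rw [natLength_isAtom hW] at hlW
  obtain ⟨h, hb, hh⟩ := hS.exists_hom_bijective (hQ.1.quotient hVt).1 (hQ.1.quotient hWt).1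
    (hQ.1.quotient hVt).2 (hQ.1.quotient hWt).2 (by omega) (by omega) hf hg hfr hgr
  obtain ⟨e, he⟩ := exists_lift_of_maximal_natLength hQ.1 hQ.2 h
  have hsurj : Function.Surjective e := by
    by_contra hns
    have h1 := range_le_jacobson_of_range_le (hQ.1.1.range_le hns) W.mkQ
    rw [he, LinearMap.range_eq_top.mpr (show Function.Surjective (h ∘ₗ V.mkQ) from hb.2.comp V.mkQ_surjective)] at h1
    exact (hQ.1.1.quotient hWt).1.1 (top_le_iff.mp h1)
  refine ⟨e, IsNoetherian.injective_of_surjective_endomorphism e hsurj, fun x hx => ?_,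
    fun x t hxt => ?_⟩
  · have h1 := LinearMap.congr_fun he x
    have h2 : V.mkQ x = 0 := (Submodule.Quotient.mk_eq_zero V).mpr hx
    rw [LinearMap.comp_apply, LinearMap.comp_apply, h2, map_zero] at h1
    exact (Submodule.Quotient.mk_eq_zero W).mp h1
  · have h1 := LinearMap.congr_fun he x
    rw [LinearMap.comp_apply, LinearMap.comp_apply, hxt] at h1
    exact h1.trans (LinearMap.congr_fun hh t)

lemma IsMaximalLocalSemisimpleRad.nonempty_equiv (hS : LongIndecLocal S)
    (hQ : IsMaximalLocalSemisimpleRad S Q) (hlen : 4 ≤ natLength S Q)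
    {V W : Submodule S Q} (hV : IsAtom V) (hW : IsAtom W) (hVW : V ≠ W)
    (hVJ : V ≤ Module.jacobson S Q) (hWJ : W ≤ Module.jacobson S Q) :
    Nonempty (V ≃ₗ[S] W) := by
  have hlJ := hQ.1.1.natLength_eq
  obtain ⟨T, hTJ, hT, hd⟩ := exists_isAtom_disjoint hQ.1.2 (sup_le hVJ hWJ) fun h0 => by
    have := natLength_sup_of_isAtom hV hW hVW
    rw [h0] at this
    omega
  have := isSimpleModule_iff_isAtom.mpr hT
  have := isSimpleModule_iff_isAtom.mpr hV
  have := isSimpleModule_iff_isAtom.mpr hW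
  obtain ⟨e, he, heV, -⟩ := hQ.exists_endomorphism hS hlen hV hW
    (mkQ_comp_subtype_injective (hd.mono_left le_sup_left))
    (mkQ_comp_subtype_injective (hd.mono_left le_sup_right))
    (hQ.1.range_mkQ_comp_subtype_le (hV.ne_top_of_natLength hlen) hTJ)
    (hQ.1.range_mkQ_comp_subtype_le (hW.ne_top_of_natLength hlen) hTJ)
  have hne : e.restrict heV ≠ 0 := fun h0 => by
    obtain ⟨x, hx⟩ := (have := IsSimpleModule.nontrivial S V; exists_ne (0 : V))
    have h1 := congrArg Subtype.val (LinearMap.congr_fun h0 x)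
    exact hx (Subtype.ext (he (h1.trans (map_zero e).symm)))
  exact ⟨LinearEquiv.ofBijective _ (LinearMap.bijective_of_ne_zero hne)⟩

lemma IsMaximalLocalSemisimpleRad.natLength_le_three {R : Type*} [CommRing R] [IsArtinianRing R]
    [Algebra R S] [Module.Finite R S] [Module R Q] [IsScalarTower R S Q]
    (hS : LongIndecLocal S) (hQ : IsMaximalLocalSemisimpleRad S Q) : natLength S Q ≤ 3 := by
  by_contra! hlen
  have hlJ := hQ.1.1.natLength_eq
  have hJ : Module.jacobson S Q ≠ ⊥ := fun h0 => by
    rw [h0, natLength_bot] at hlJ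
    omega
  obtain ⟨V, hVJ, hV⟩ := exists_isAtom_le hJ
  obtain ⟨T, hTJ, hT, hVT⟩ := exists_isAtom_disjoint hQ.1.2 hVJ fun h0 => by
    have := natLength_isAtom hV
    rw [h0] at this
    omega
  have hne : V ≠ T := fun h0 => hT.1 (disjoint_self.mp (h0 ▸ hVT))
  obtain ⟨T', hTJ', hT', hVT'⟩ := exists_isAtom_disjoint hQ.1.2 (sup_le hVJ hTJ) fun h0 => by
    have := natLength_sup_of_isAtom hV hT hne
    rw [h0] at this
    omega
  have hne' : V ≠ T' := fun h0 => by
    rw [← h0] at hVT'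
    exact hV.1 (disjoint_self.mp (hVT'.mono_left le_sup_left))
  have := isSimpleModule_iff_isAtom.mpr hT
  have := isSimpleModule_iff_isAtom.mpr hV
  obtain ⟨θ⟩ := hQ.nonempty_equiv hS hlen hV hT hne hVJ hTJ
  obtain ⟨θ'⟩ := hQ.nonempty_equiv hS hlen hV hT' hne' hVJ hTJ'
  have hVt := hV.ne_top_of_natLength hlen
  let E : Submodule R (Q →ₗ[S] Q) :=
    { carrier := {e | ∀ v ∈ V, e v ∈ V}
      add_mem' := fun ha hb v hv => V.add_mem (ha v hv) (hb v hv)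
      zero_mem' := fun v _ => V.zero_mem
      smul_mem' := fun r e he v hv => V.smul_of_tower_mem r (he v hv) }
  let ρ : E →ₗ[R] (V →ₗ[S] V) :=
    { toFun := fun e => e.1.restrict e.2
      map_add' := fun _ _ => rfl
      map_smul' := fun _ _ => rfl }
  let π : E →ₗ[R] (T →ₗ[S] Q ⧸ V) :=
    { toFun := fun e => V.mkQ ∘ₗ e.1 ∘ₗ T.subtype
      map_add' := fun _ _ => rfl
      map_smul' := fun _ _ => rfl }
  let κ : ((V →ₗ[S] V) × (V →ₗ[S] V)) →ₗ[R] (T →ₗ[S] Q ⧸ V) :=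
    { toFun := fun p => V.mkQ ∘ₗ (T.subtype ∘ₗ θ ∘ₗ p.1 + T'.subtype ∘ₗ θ' ∘ₗ p.2) ∘ₗ θ.symm
      map_add' := fun p q => by
        ext x
        simp only [Prod.fst_add, Prod.snd_add, LinearMap.comp_add, LinearMap.add_comp,
          LinearMap.add_apply]
        abel
      map_smul' := fun r p => by
        ext x
        have h1 : θ (r • p.1 (θ.symm x)) = r • θ (p.1 (θ.symm x)) :=
          (θ : V →ₗ[S] T).map_smul_of_tower r _
        have h2 : θ' (r • p.2 (θ.symm x)) = r • θ' (p.2 (θ.symm x)) :=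
          (θ' : V →ₗ[S] T').map_smul_of_tower r _
        simp [h1, h2] }
  have hπ : Function.Surjective π := by
    intro φ
    by_cases hφ : φ = 0
    · exact ⟨0, by rw [map_zero, hφ]⟩
    · have hinj := LinearMap.injective_of_ne_zero hφ
      have hr : LinearMap.range φ ≤ Module.jacobson S (Q ⧸ V) := by
        refine (hQ.1.1.quotient hVt).1.range_le fun hs => ?_
        have h1 := natLength_eq_of_equiv (LinearEquiv.ofBijective φ ⟨hinj, hs⟩)
        have h2 := natLength_add_quotient V
        have h3 := natLength_isAtom hT
        have h4 := natLength_isAtom hV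
        omega
      obtain ⟨e, -, heV, he⟩ := hQ.exists_endomorphism hS hlen hV hV
        (mkQ_comp_subtype_injective hVT) hinj (hQ.1.range_mkQ_comp_subtype_le hVt hTJ) hr
      exact ⟨⟨e, heV⟩, LinearMap.ext fun t => he t t rfl⟩
  have hker : LinearMap.ker ρ ≤ LinearMap.ker π := by
    intro e he
    obtain ⟨v, hv⟩ := (have := IsSimpleModule.nontrivial S V; exists_ne (0 : V))
    have h1 : e.1 v = 0 := congrArg Subtype.val (LinearMap.congr_fun he v)
    have h2 : ¬ Function.Surjective e.1 := fun hs => hv <| Subtype.ext <|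
      IsNoetherian.injective_of_surjective_endomorphism e.1 hs (h1.trans (map_zero e.1).symm)
    refine LinearMap.ext fun t => ?_
    have h3 : e.1 t = 0 :=
      map_eq_zero_of_mem_jacobson hQ.1.2 (hQ.1.1.range_le h2) (hTJ t.2)
    exact (congrArg V.mkQ h3).trans (map_zero _)
  have hκ : Function.Injective κ := by
    rw [← LinearMap.ker_eq_bot, eq_bot_iff]
    rintro ⟨a, b⟩ hab
    have key : ∀ x, a x = 0 ∧ b x = 0 := by
      intro x
      have h1 := LinearMap.congr_fun (LinearMap.mem_ker.mp hab) (θ x)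
      have h2 : V.mkQ ((θ (a (θ.symm (θ x))) : Q) + θ' (b (θ.symm (θ x)))) = 0 := h1
      rw [θ.symm_apply_apply] at h2
      have h3 := (Submodule.Quotient.mk_eq_zero V).mp h2
      have h4 : (θ' (b x) : Q) ∈ V ⊔ T := by
        have := sub_mem (Submodule.mem_sup_left (T := T) h3)
          (Submodule.mem_sup_right (S := V) (θ (a x)).2)
        rwa [add_sub_cancel_left] at this
      have h5 := Submodule.disjoint_def.mp hVT' _ h4 (θ' (b x)).2
      rw [h5, add_zero] at h3
      have h6 := Submodule.disjoint_def.mp hVT _ h3 (θ (a x)).2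
      exact ⟨by simpa using h6, by simpa using h5⟩
    exact Prod.ext (LinearMap.ext fun x => (key x).1) (LinearMap.ext fun x => (key x).2)
  have : Module.Finite R Q := Module.Finite.trans S Q
  obtain ⟨v, hv⟩ := (have := IsSimpleModule.nontrivial S V; exists_ne (0 : V))
  let ev : (V →ₗ[S] V) →ₗ[R] Q :=
    { toFun := fun a => a v
      map_add' := fun _ _ => rfl
      map_smul' := fun _ _ => rfl }
  have hev : Function.Injective ev := by
    rw [← LinearMap.ker_eq_bot, eq_bot_iff]
    intro a ha
    by_contra hne0
    exact hv (LinearMap.injective_of_ne_zero hne0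
      ((Subtype.ext ha : a v = 0).trans (map_zero a).symm))
  have : IsNoetherian R (V →ₗ[S] V) := isNoetherian_of_injective ev hev
  have : IsArtinian R (V →ₗ[S] V) := isArtinian_of_injective ev hev
  have l1 := Module.length_le_of_injective κ hκ
  have l2 := Module.length_le_of_surjective ((LinearMap.ker ρ).liftQ π hker)
    (fun x => (hπ x).elim fun e he => ⟨Submodule.Quotient.mk e, he⟩)
  have l3 := Module.length_le_of_injective ((LinearMap.ker ρ).liftQ ρ le_rfl)
    (LinearMap.ker_eq_bot.mp (Submodule.ker_liftQ_eq_bot' _ _ rfl))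
  have l4 := l1.trans (l2.trans l3)
  rw [Module.length_prod, ← coe_natLength] at l4
  norm_cast at l4
  have := natLength_eq_zero (S := R) (M := V →ₗ[S] V) (by omega)
  have h0 := LinearMap.congr_fun (Subsingleton.elim (LinearMap.id : V →ₗ[S] V) 0) v
  exact hv h0

/-- If long indecomposable modules are local, then local modules with semisimple radical have
length at most three, provided their lengths are bounded. -/
lemma LongIndecLocal.natLength_le_three {R : Type*} [CommRing R] [IsArtinianRing R]
    [Algebra R S] [Module.Finite R S] (hS : LongIndecLocal S) {b : ℕ}
    (hb : ∀ (X : Type u) [AddCommGroup X] [Module S X], Module.Finite S X →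
      IsLocalSemisimpleRad S X → natLength S X ≤ b) {P : Type u}
    [AddCommGroup P] [Module S P] [IsNoetherian S P] (hP : IsLocalSemisimpleRad S P) :
    natLength S P ≤ 3 := by
  have : IsArtinianRing S := IsArtinianRing.of_finite R S
  let L : Set ℕ := {n | ∃ (X : Type u) (_ : AddCommGroup X) (_ : Module S X),
    Module.Finite S X ∧ IsLocalSemisimpleRad S X ∧ natLength S X = n}
  have hL : BddAbove L := ⟨b, by
    rintro _ ⟨X, _, _, hX, hX', rfl⟩
    exact hb X hX hX'⟩
  have hPL : natLength S P ∈ L := ⟨P, _, _, inferInstance, hP, rfl⟩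
  obtain ⟨X, _, _, hX, hX', hXn⟩ := Nat.sSup_mem ⟨_, hPL⟩ hL
  let _ : Module R X := Module.compHom X (algebraMap R S)
  have : IsScalarTower R S X := ⟨fun r s x => by
    rw [Algebra.smul_def, mul_smul]
    rfl⟩
  refine (le_csSup hL hPL).trans (hXn ▸ ?_)
  exact IsMaximalLocalSemisimpleRad.natLength_le_three (R := R) hS
    ⟨hX', fun Y _ _ hY hY' => hXn ▸ le_csSup hL ⟨Y, _, _, hY, hY', rfl⟩⟩

end SemisimpleRadical

section RadicalSeries

variable {S : Type*} [Ring S] {M : Type*} [AddCommGroup M] [Module S M]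

lemma radPow_succ_le (n : ℕ) : radPow S M (n + 1) ≤ radPow S M n :=
  Submodule.map_subtype_le _ _

lemma radPow_antitone : Antitone (radPow S M) :=
  antitone_nat_of_succ_le radPow_succ_le

lemma radPow_one : radPow S M 1 = Module.jacobson S M :=
  Module.map_jacobson_of_bijective (f := (⊤ : Submodule S M).subtype)
    ⟨Subtype.val_injective, fun x => ⟨⟨x, trivial⟩, rfl⟩⟩

lemma radPow_two : radPow S M 2 = radOf (Module.jacobson S M) := by
  rw [← radPow_one]
  rfl

lemma isUniserialModule_quotient_iff {P : Submodule S M} :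
    IsUniserialModule S (M ⧸ P) ↔ ∀ A B, P ≤ A → P ≤ B → A ≤ B ∨ B ≤ A := by
  constructor
  · intro h A B hA hB
    have key : ∀ {A B : Submodule S M}, P ≤ A → P ≤ B → A.map P.mkQ ≤ B.map P.mkQ → A ≤ B := by
      intro A B hA hB hAB
      have := Submodule.comap_mono (f := P.mkQ) hAB
      rwa [Submodule.comap_map_mkQ, Submodule.comap_map_mkQ, sup_eq_right.mpr hA,
        sup_eq_right.mpr hB] at this
    exact (h (A.map P.mkQ) (B.map P.mkQ)).imp (key hA hB) (key hB hA)
  · intro h A B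
    have key : ∀ {A B : Submodule S (M ⧸ P)}, A.comap P.mkQ ≤ B.comap P.mkQ → A ≤ B :=
      fun hAB => (Submodule.comap_le_comap_iff_of_surjective P.mkQ_surjective).mp hAB
    exact (h (A.comap P.mkQ) (B.comap P.mkQ) (Submodule.le_comap_mkQ P A)
      (Submodule.le_comap_mkQ P B)).imp key key

variable [IsArtinian S M] [IsNoetherian S M]

lemma isCoatom_of_natLength {P : Submodule S M} (h : natLength S M = natLength S P + 1) :
    IsCoatom P :=
  covBy_top_iff.mp (covBy_of_natLength le_top ((natLength_top).trans h))

lemma isCoatom_comap_subtype {C N : Submodule S M} (h : C ⋖ N) :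
    IsCoatom (C.comap N.subtype) :=
  isCoatom_of_natLength (by rw [natLength_comap_subtype h.le, natLength_covBy h])

lemma covBy_map_subtype {N : Submodule S M} {C : Submodule S N} (h : IsCoatom C) :
    C.map N.subtype ⋖ N :=
  covBy_of_natLength (Submodule.map_subtype_le N C)
    (by rw [natLength_map_subtype, natLength_isCoatom h])

lemma radOf_le_of_covBy {C N : Submodule S M} (h : C ⋖ N) : radOf N ≤ C :=
  Submodule.map_le_iff_le_comap.mpr (sInf_le (isCoatom_comap_subtype h))

lemma le_radOf_of_covBy {C N : Submodule S M} (hC : C ≤ N) (h : ∀ D, D ⋖ N → C ≤ D) :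
    C ≤ radOf N := by
  intro x hx
  refine ⟨⟨x, hC hx⟩, Submodule.mem_sInf.mpr fun D hD => ?_, rfl⟩
  obtain ⟨y, hy, hyx⟩ := h _ (covBy_map_subtype hD) hx
  rwa [← Subtype.ext (a1 := y) (a2 := ⟨x, hC hx⟩) hyx]

lemma exists_covBy_of_lt {X N : Submodule S M} (h : X < N) : ∃ C, C ⋖ N ∧ X ≤ C := by
  have hne : X.comap N.subtype ≠ ⊤ := fun h0 =>
    h.not_ge (Submodule.comap_subtype_eq_top.mp h0)
  obtain h0 | ⟨D, hD, hle⟩ := IsCoatomic.eq_top_or_exists_le_coatom (X.comap N.subtype)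
  · exact absurd h0 hne
  · exact ⟨D.map N.subtype, covBy_map_subtype hD,
      fun x hx => ⟨⟨x, h.le hx⟩, hle hx, rfl⟩⟩

/-- A submodule with a unique lower cover is local. -/
lemma hasLocalTop_of_unique_covBy {N : Submodule S M} (hN : N ≠ ⊥)
    (h : ∀ C D, C ⋖ N → D ⋖ N → C = D) : HasLocalTop S N := by
  obtain ⟨C, hC, -⟩ := exists_covBy_of_lt hN.bot_lt
  refine hasLocalTop_of_isLocalModule ⟨_, isCoatom_comap_subtype hC, fun D hD => ?_⟩
  rw [h C _ hC (covBy_map_subtype hD), Submodule.comap_map_eq_of_injective N.subtype_injective]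

/-- If `M / rad^k M` is uniserial, its submodules are the images of the iterated radicals. -/
lemma exists_eq_radPow {k : ℕ}
    (h : ∀ A B, radPow S M k ≤ A → radPow S M k ≤ B → A ≤ B ∨ B ≤ A) {X : Submodule S M}
    (hX : radPow S M k ≤ X) : ∃ j ≤ k, X = radPow S M j := by
  induction k with
  | zero => exact ⟨0, le_rfl, top_le_iff.mp hX⟩
  | succ k ih =>
    have hk := radPow_succ_le (S := S) (M := M) k
    have ih' : radPow S M k ≤ X → ∃ j ≤ k + 1, X = radPow S M j := fun hXk => by
      obtain ⟨j, hj, hXj⟩ := ih (fun A B hA hB => h A B (hk.trans hA) (hk.trans hB)) hXk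
      exact ⟨j, by omega, hXj⟩
    rcases h X _ hX hk with hle | hle
    · rcases hle.lt_or_eq with hlt | heq
      · refine ⟨k + 1, le_rfl, le_antisymm ?_ hX⟩
        obtain ⟨C, hC, hXC⟩ := exists_covBy_of_lt hlt
        refine hXC.trans (le_radOf_of_covBy hC.le fun D hD => ?_)
        rcases h C D (radOf_le_of_covBy hC) (radOf_le_of_covBy hD) with h' | h'
        · exact h'
        · rcases hD.eq_or_eq h' hC.le with h2 | h2
          · exact h2.le
          · exact absurd h2 hC.ne
      · exact ih' heq.ge
    · exact ih' hle

lemma eq_of_covBy_radPow {k j : ℕ} (hj : j < k)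
    (h : ∀ A B, radPow S M k ≤ A → radPow S M k ≤ B → A ≤ B ∨ B ≤ A) {C D : Submodule S M}
    (hC : C ⋖ radPow S M j) (hD : D ⋖ radPow S M j) : C = D := by
  have hle := radPow_antitone (S := S) (M := M) (Nat.succ_le_of_lt hj)
  rcases h C D (hle.trans (radOf_le_of_covBy hC)) (hle.trans (radOf_le_of_covBy hD)) with h' | h'
  · exact ((hC.eq_or_eq h' hD.le).resolve_right hD.ne).symm
  · exact (hD.eq_or_eq h' hC.le).resolve_right hC.ne

/-- If `M / rad^k M` is uniserial but `M / rad^(k+1) M` is not, then `rad^k M` has two maximal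
submodules. -/
lemma exists_two_covBy_radPow {k : ℕ} (h : IsUniserialModule S (M ⧸ radPow S M k))
    (h' : ¬ IsUniserialModule S (M ⧸ radPow S M (k + 1))) :
    ∃ C D, C ⋖ radPow S M k ∧ D ⋖ radPow S M k ∧ C ≠ D := by
  rw [isUniserialModule_quotient_iff] at h h'
  by_contra! hno
  refine h' ?_
  have key : ∀ N, radPow S M (k + 1) ≤ N → radPow S M k ≤ N ∨ N = radPow S M (k + 1) := by
    intro N hN
    obtain ⟨j, hj, hXj⟩ := exists_eq_radPow h (X := N ⊔ radPow S M k) le_sup_right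
    rcases (hXj ▸ le_sup_left : N ≤ radPow S M j).lt_or_eq with hlt | heq
    · obtain ⟨C, hC, hNC⟩ := exists_covBy_of_lt hlt
      rcases hj.lt_or_eq with hjk | rfl
      · have h1 : radPow S M k ≤ C :=
          (radPow_antitone (Nat.succ_le_of_lt hjk)).trans (radOf_le_of_covBy hC)
        exact absurd (hXj ▸ sup_le hNC h1) hC.lt.not_ge
      · refine Or.inr (le_antisymm (hNC.trans ?_) hN)
        exact le_radOf_of_covBy hC.le fun D hD => (hno C D hC hD).le
    · exact Or.inl (heq ▸ radPow_antitone hj)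
  intro A B hA hB
  rcases key A hA with hA' | rfl
  · rcases key B hB with hB' | rfl
    · exact h A B hA' hB'
    · exact Or.inr hA
  · exact Or.inl hB

end RadicalSeries

section NakayamaBound

lemma HasLocalTop.isIndecModule {S M : Type*} [Ring S] [AddCommGroup M] [Module S M]
    (h : HasLocalTop S M) : IsIndecModule S M := by
  refine ⟨?_, fun N P hNP => ?_⟩
  · by_contra hM
    rw [not_nontrivial_iff_subsingleton] at hM
    exact h.1 (Subsingleton.elim _ _)
  · by_cases hN : N = ⊤
    · right
      simpa [hN] using hNP.disjoint
    by_cases hP : P = ⊤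
    · left
      simpa [hP] using hNP.disjoint
    exact absurd (top_le_iff.mp (hNP.sup_eq_top ▸ sup_le (h.2 N hN) (h.2 P hP))) h.1

/-- Every finitely generated indecomposable module `X` has a uniserial factor module
`X / rad^(l-4) X`, where `l` is the length of `X`. -/
def FactorSerialBound (S : Type u) [Ring S] : Prop :=
  ∀ (X : Type u) [AddCommGroup X] [Module S X], Module.Finite S X → IsIndecModule S X →
    ∀ A B, radPow S X (natLength S X - 4) ≤ A → radPow S X (natLength S X - 4) ≤ B →
      A ≤ B ∨ B ≤ A

variable {S : Type u} [Ring S]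

lemma FactorSerialBound.longIndecLocal (hS : FactorSerialBound S) : LongIndecLocal S := by
  intro X _ _ hX hind hlen
  have := hind.1
  obtain ⟨C, hC⟩ := IsCoatomic.exists_coatom (Submodule S X)
  have hj : radPow S X (natLength S X - 4) ≤ Module.jacobson S X :=
    radPow_one (S := S) (M := X) ▸ radPow_antitone (by omega)
  refine ⟨C, hC, fun D hD => ?_⟩
  rcases hS X hX hind C D (hj.trans (sInf_le hC)) (hj.trans (sInf_le hD)) with h | h
  · exact ((hC.le_iff_eq hD.1).mp h)
  · exact ((hD.le_iff_eq hC.1).mp h).symm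

variable [IsArtinianRing S]

lemma natLength_eq_of_moduleLength {M : Type*} [AddCommGroup M] [Module S M]
    [Module.Finite S M] {l : ℕ} (h : moduleLength S M = l) : natLength S M = l := by
  rw [moduleLength_eq_natLength] at h
  exact_mod_cast h

lemma IsRightNNakayama.factorSerialBound {Λ : Type u} [Ring Λ] [IsArtinianRing Λᵐᵒᵖ]
    (hΛ : IsRightNNakayama Λ 4) : FactorSerialBound Λᵐᵒᵖ := by
  intro X _ _ hX hind A B hA hB
  obtain ⟨i, -, hi, ⟨-, hu⟩ | ⟨-, -, l, hl, -, hu, -⟩⟩ := hΛ.1 (ModuleCat.of _ X) hX hind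
  · exact hu A B
  · have hl' : natLength Λᵐᵒᵖ X = l := natLength_eq_of_moduleLength hl
    have hle := radPow_antitone (S := Λᵐᵒᵖ) (M := X) (by omega : natLength Λᵐᵒᵖ X - 4 ≤ l - i)
    exact isUniserialModule_quotient_iff.mp hu A B (hle.trans hA) (hle.trans hB)

lemma FactorSerialBound.natLength_le_five (hS : FactorSerialBound S) (X : Type u)
    [AddCommGroup X] [Module S X] (hX : Module.Finite S X) (h : IsLocalSemisimpleRad S X) :
    natLength S X ≤ 5 := by
  by_contra! hlen
  have hlJ := h.1.natLength_eq
  have h2 : radPow S X (natLength S X - 4) = ⊥ := by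
    refine le_bot_iff.mp ((radPow_antitone (by omega : 2 ≤ natLength S X - 4)).trans ?_)
    rw [radPow_two]
    exact (congrArg (Submodule.map _) h.2).trans (Submodule.map_bot _) |>.le
  have hJ : Module.jacobson S X ≠ ⊥ := fun h0 => by
    rw [h0, natLength_bot] at hlJ
    omega
  obtain ⟨V, hVJ, hV⟩ := exists_isAtom_le hJ
  obtain ⟨T, hTJ, hT, hVT⟩ := exists_isAtom_disjoint h.2 hVJ fun h0 => by
    have := natLength_isAtom hV
    rw [h0] at this
    omega
  rcases hS X hX h.1.isIndecModule V T (h2 ▸ bot_le) (h2 ▸ bot_le) with h3 | h3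
  · exact hV.1 (hVT.eq_bot_of_le h3)
  · exact hT.1 (hVT.symm.eq_bot_of_le h3)

end NakayamaBound

section Tower

variable {S : Type u} [Ring S]

lemma jacobson_sup_isAtom {M : Type*} [AddCommGroup M] [Module S M] [IsArtinian S M]
    [IsNoetherian S M] {c d : Submodule S M} (hc : IsAtom c) (hd : IsAtom d) (h : c ≠ d) :
    Module.jacobson S ↥(c ⊔ d) = ⊥ := by
  have hl : natLength S ↥(c ⊔ d) = 2 := by
    have h1 := natLength_sup_add_inf c d
    rw [(hc.disjoint_of_ne hd h).eq_bot, natLength_bot, natLength_isAtom hc,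
      natLength_isAtom hd] at h1
    omega
  have hc' : IsCoatom (c.comap (c ⊔ d).subtype) := isCoatom_of_natLength (by
    rw [natLength_comap_subtype le_sup_left, natLength_isAtom hc, hl])
  have hd' : IsCoatom (d.comap (c ⊔ d).subtype) := isCoatom_of_natLength (by
    rw [natLength_comap_subtype le_sup_right, natLength_isAtom hd, hl])
  rw [eq_bot_iff]
  intro x hx
  exact Subtype.ext (Submodule.disjoint_def.mp (hc.disjoint_of_ne hd h) x
    (Submodule.mem_sInf.mp hx _ hc') (Submodule.mem_sInf.mp hx _ hd'))

lemma exists_factor {A B C : Type*} [AddCommGroup A] [Module S A] [AddCommGroup B] [Module S B]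
    [AddCommGroup C] [Module S C] {ι : B →ₗ[S] C} (hι : Function.Injective ι) {h : A →ₗ[S] C}
    (hr : ∀ y, h y ∈ LinearMap.range ι) : ∃ g : A →ₗ[S] B, ∀ y, ι (g y) = h y :=
  ⟨(LinearEquiv.ofInjective ι hι).symm ∘ₗ h.codRestrict (LinearMap.range ι) hr, fun y =>
    congrArg Subtype.val
      (LinearEquiv.apply_symm_apply (LinearEquiv.ofInjective ι hι) ⟨h y, hr y⟩)⟩

variable {P A : Type u} [AddCommGroup P] [Module S P] [AddCommGroup A] [Module S A]
  [IsArtinian S P] [IsNoetherian S P] [IsArtinian S A] [IsNoetherian S A]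

lemma natLength_map_mkQ_add {H C : Submodule S A} (h : H ≤ C) :
    natLength S (C.map H.mkQ) + natLength S H = natLength S C := by
  have h1 := natLength_range_add_ker (H.mkQ ∘ₗ C.subtype)
  rw [LinearMap.range_comp, Submodule.range_subtype, LinearMap.ker_comp, Submodule.ker_mkQ,
    natLength_comap_subtype h] at h1
  omega

/-- A local module with local radical cannot have a second radical with two maximal
submodules. -/
lemma LongIndecLocal.false_of_two_covBy (hS : LongIndecLocal S) (hP : HasLocalTop S P)
    (hA : HasLocalTop S A) {i : A →ₗ[S] P} (hi : Function.Injective i)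
    (hir : LinearMap.range i = Module.jacobson S P) {C D : Submodule S A}
    (hC : C ⋖ Module.jacobson S A) (hD : D ⋖ Module.jacobson S A) (hCD : C ≠ D) : False := by
  have lP := hP.natLength_eq
  have lA := hA.natLength_eq
  have lC := natLength_covBy hC
  have lD := natLength_covBy hD
  have lAi : natLength S A = natLength S (Module.jacobson S P) := by
    rw [← hir]
    exact natLength_eq_of_equiv (LinearEquiv.ofInjective i hi)
  have hsup : C ⊔ D = Module.jacobson S A := by
    rcases hC.eq_or_eq (le_sup_left : C ≤ C ⊔ D) (sup_le hC.le hD.le) with h | h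
    · have hDC : D ≤ C := h ▸ le_sup_right
      exact absurd ((hD.eq_or_eq hDC hC.le).resolve_right hC.ne) hCD
    · exact h
  have lH := natLength_sup_add_inf C D
  rw [hsup] at lH
  set H := C ⊓ D with hH
  have hHC : H ≤ C := inf_le_left
  have hHD : H ≤ D := inf_le_right
  have lcH := natLength_map_mkQ_add hHC
  have ldH := natLength_map_mkQ_add hHD
  have hHt : H ≠ ⊤ := fun h0 => by
    rw [h0, natLength_top] at lH
    omega
  have hiHt : H.map i ≠ ⊤ := fun h0 => hP.1 (top_le_iff.mp (by
    rw [← h0, ← hir]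
    exact LinearMap.map_le_range))
  have lHi : natLength S (H.map i) = natLength S H :=
    (natLength_eq_of_equiv (Submodule.equivMapOfInjective i hi H)).symm
  have lY := natLength_add_quotient H
  have lZ := natLength_add_quotient (H.map i)
  obtain ⟨hY, hYj⟩ := hA.quotient hHt
  obtain ⟨hZ, hZj⟩ := hP.quotient hiHt
  have hc : IsAtom (C.map H.mkQ) := isAtom_of_natLength (by omega)
  have hd : IsAtom (D.map H.mkQ) := isAtom_of_natLength (by omega)
  have hcd : C.map H.mkQ ≠ D.map H.mkQ := fun h0 => hCD <| by
    have := congrArg (Submodule.comap H.mkQ) h0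
    rwa [Submodule.comap_map_mkQ, Submodule.comap_map_mkQ, sup_eq_right.mpr hHC,
      sup_eq_right.mpr hHD] at this
  have hYcd : Module.jacobson S (A ⧸ H) = C.map H.mkQ ⊔ D.map H.mkQ := by
    rw [hYj, ← hsup, Submodule.map_sup]
  let ι : (A ⧸ H) →ₗ[S] (P ⧸ H.map i) := H.mapQ (H.map i) i (Submodule.le_comap_map i H)
  have hι : Function.Injective ι := by
    rw [← LinearMap.ker_eq_bot, Submodule.ker_mapQ, Submodule.comap_map_eq_of_injective hi]
    exact (Submodule.mkQ_map_self H)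
  have hιr : LinearMap.range ι = Module.jacobson S (P ⧸ H.map i) := by
    rw [hZj, ← hir, ← LinearMap.range_comp]
    have : (H.map i).mkQ ∘ₗ i = ι ∘ₗ H.mkQ := rfl
    rw [this, LinearMap.range_comp, Submodule.range_mkQ, Submodule.map_top]
  obtain ⟨h, hhc, hhd⟩ := hS.exists_hom_of_jacobson_eq_sup hZ hY (by omega) hι hιr.le hc hd hcd
    hYcd
  have hr : ∀ y, h y ∈ LinearMap.range ι := fun y => by
    rw [hιr]
    refine hZ.range_le (fun hs => ?_) ⟨y, rfl⟩
    have := natLength_range_add_ker h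
    rw [LinearMap.range_eq_top.mpr hs, natLength_top] at this
    omega
  obtain ⟨g, hg⟩ := exists_factor hι hr
  obtain ⟨x, hx, hx0⟩ := (Submodule.ne_bot_iff _).mp hc.1
  obtain ⟨y, hy, hy0⟩ := (Submodule.ne_bot_iff _).mp hd.1
  refine hY.false_of_endomorphism (g := g) ?_ hx0 (hι ?_) hy0 ?_ (hι ?_)
  · rw [hYcd]
    exact jacobson_sup_isAtom hc hd hcd
  · rw [hg, hhc x hx, map_zero]
  · rw [hYcd]
    exact Submodule.mem_sup_right hy
  · rw [hg, hhd y hy]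

/-- A local four-factor serial module has length five. -/
lemma LongIndecLocal.natLength_eq_five [IsArtinianRing S] {M : Type u} [AddCommGroup M]
    [Module S M] [Module.Finite S M] (hS : LongIndecLocal S) (hM : HasLocalTop S M)
    (hfs : IsNFactorSerial S M 4) : natLength S M = 5 := by
  obtain ⟨-, -, l, hl, h4, hu, hnu⟩ := hfs
  rw [natLength_eq_of_moduleLength hl]
  by_contra hne
  obtain ⟨C, D, hC, hD, hCD⟩ := exists_two_covBy_radPow hu hnu
  rw [isUniserialModule_quotient_iff] at hu
  obtain h0 | h0 | ⟨b, hb⟩ : l - 4 = 0 ∨ l - 4 = 1 ∨ ∃ b, l - 4 = b + 2 := by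
    rcases l - 4 with _ | _ | b
    · simp
    · simp
    · exact Or.inr (Or.inr ⟨b, rfl⟩)
  · rw [h0] at hC hD
    have hC' : IsCoatom C := covBy_top_iff.mp hC
    have hD' : IsCoatom D := covBy_top_iff.mp hD
    exact hCD (hM.isLocalModule.unique hC' hD')
  · omega
  · rw [hb] at hC hD hu
    have hbot : ∀ j ≤ b + 2, radPow S M j ≠ ⊥ := fun j hj h0 =>
      (bot_le.trans_lt hC.lt).not_ge ((radPow_antitone hj).trans h0.le)
    have hloc : ∀ j < b + 2, HasLocalTop S (radPow S M j) := fun j hj =>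
      hasLocalTop_of_unique_covBy (hbot j hj.le) fun C D hC hD => eq_of_covBy_radPow hj hu hC hD
    have hmap : radPow S M (b + 2) =
      (Module.jacobson S (radPow S M (b + 1))).map (radPow S M (b + 1)).subtype := rfl
    have hcov : ∀ {C}, C ⋖ radPow S M (b + 2) →
        C.comap (radPow S M (b + 1)).subtype ⋖ Module.jacobson S (radPow S M (b + 1)) := by
      intro C hC
      refine covBy_of_natLength ?_ ?_
      · have := Submodule.comap_mono (f := (radPow S M (b + 1)).subtype) (hC.le.trans hmap.le)
        rwa [Submodule.comap_map_eq_of_injective (Submodule.subtype_injective _)] at this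
      · rw [natLength_comap_subtype (hC.le.trans (radPow_succ_le (b + 1))), ← natLength_covBy hC,
          hmap, natLength_map_subtype]
    refine hS.false_of_two_covBy (hloc b (by omega)) (hloc (b + 1) (by omega))
      (i := Submodule.inclusion (radPow_succ_le b)) (Submodule.inclusion_injective _) ?_
      (hcov hC) (hcov hD) fun h0 => hCD ?_
    · rw [Submodule.range_inclusion]
      exact Submodule.comap_map_eq_of_injective (Submodule.subtype_injective _) _
    · have h1 := congrArg (Submodule.map (radPow S M (b + 1)).subtype) h0
      rwa [Submodule.map_comap_subtype, Submodule.map_comap_subtype,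
        inf_eq_right.mpr (hC.le.trans (radPow_succ_le (b + 1))),
        inf_eq_right.mpr (hD.le.trans (radPow_succ_le (b + 1)))] at h1

end Tower

section Submodules

variable {S : Type*} [Ring S] {M : Type*} [AddCommGroup M] [Module S M]

lemma isUniserialModule_of_le {N : Submodule S M} (h : ∀ A B, A ≤ N → B ≤ N → A ≤ B ∨ B ≤ A) :
    IsUniserialModule S N := fun A B => by
  rw [← Submodule.map_le_map_iff_of_injective N.subtype_injective A B,
    ← Submodule.map_le_map_iff_of_injective N.subtype_injective B A]
  exact h _ _ (Submodule.map_subtype_le N A) (Submodule.map_subtype_le N B)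

lemma IsUniserialModule.le_total_of_le {N A B : Submodule S M} (h : IsUniserialModule S N)
    (hA : A ≤ N) (hB : B ≤ N) : A ≤ B ∨ B ≤ A := by
  have key : ∀ {A B : Submodule S M}, A ≤ N →
      A.comap N.subtype ≤ B.comap N.subtype → A ≤ B :=
    fun hA hAB x hx => hAB (x := ⟨x, hA hx⟩) hx
  exact (h (A.comap N.subtype) (B.comap N.subtype)).imp (key hA) (key hB)

lemma IsUniserialModule.eq_of_isAtom {N A B : Submodule S M} (h : IsUniserialModule S N)
    (hA : A ≤ N) (hB : B ≤ N) (hA' : IsAtom A) (hB' : IsAtom B) : A = B := by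
  rcases h.le_total_of_le hA hB with h' | h'
  · exact (hB'.le_iff_eq hA'.1).mp h'
  · exact ((hA'.le_iff_eq hB'.1).mp h').symm

lemma radOf_mono {X Y : Submodule S M} (h : X ≤ Y) : radOf X ≤ radOf Y := by
  have h1 := Module.map_jacobson_le (Submodule.inclusion h)
  have h2 := Submodule.map_mono (f := Y.subtype) h1
  rw [← Submodule.map_comp] at h2
  exact h2

lemma sup_eq_of_covBy {C D L : Submodule S M} (hC : C ⋖ L) (hD : D ≤ L) (h : ¬ D ≤ C) :
    C ⊔ D = L := by
  rcases hC.eq_or_eq (le_sup_left : C ≤ C ⊔ D) (sup_le hC.le hD) with h' | h'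
  · exact absurd (h' ▸ le_sup_right) h
  · exact h'

lemma le_jacobson_of_isAtom (hM : HasLocalTop S M) (h5 : natLength S M = 5) {T : Submodule S M}
    (hT : IsAtom T) : T ≤ Module.jacobson S M :=
  hM.2 T fun h0 => by
    have := natLength_isAtom hT
    rw [h0, natLength_top] at this
    omega

variable [IsArtinian S M] [IsNoetherian S M]

lemma isAtom_comap_subtype {c N : Submodule S M} (hc : IsAtom c) (h : c ≤ N) :
    IsAtom (c.comap N.subtype) :=
  isAtom_of_natLength (by rw [natLength_comap_subtype h, natLength_isAtom hc])

lemma socOf_eq_of_isAtom {c N : Submodule S M} (hc : IsAtom c) (h : c ≤ N)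
    (hu : ∀ T, IsAtom T → T ≤ N → T = c) : socOf N = c := by
  refine le_antisymm ?_ ?_
  · refine Submodule.map_le_iff_le_comap.mpr (sSup_le fun T hT => ?_)
    rw [← Submodule.map_le_iff_le_comap]
    refine (hu _ (isAtom_of_natLength ?_) (Submodule.map_subtype_le N T)).le
    rw [natLength_map_subtype, natLength_isAtom hT]
  · have hle : c.comap N.subtype ≤ moduleSoc S N := le_sSup (isAtom_comap_subtype hc h)
    exact fun x hx => ⟨⟨x, h hx⟩, hle hx, rfl⟩

lemma IsUniserialModule.exists_socOf_eq {N : Submodule S M} (h : IsUniserialModule S N)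
    (hN : N ≠ ⊥) : ∃ c ≤ N, IsAtom c ∧ socOf N = c := by
  obtain ⟨c, hcN, hc⟩ := exists_isAtom_le hN
  exact ⟨c, hcN, hc, socOf_eq_of_isAtom hc hcN fun T hT hTN => h.eq_of_isAtom hTN hcN hT hc⟩

lemma HasLocalTop.isUniserialModule (h : HasLocalTop S M) (h2 : natLength S M = 2) :
    IsUniserialModule S M := by
  have hJ : IsAtom (Module.jacobson S M) := isAtom_of_natLength (by
    have := h.natLength_eq
    omega)
  intro A B
  by_cases hA : A = ⊤
  · exact Or.inr (hA ▸ le_top)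
  by_cases hB : B = ⊤
  · exact Or.inl (hB ▸ le_top)
  rcases hJ.le_iff.mp (h.2 A hA) with rfl | hA'
  · exact Or.inl bot_le
  · exact Or.inr (hA' ▸ h.2 B hB)

lemma eq_of_sup_radOf_eq {X L : Submodule S M} (hX : X ≤ L) (h : X ⊔ radOf L = L) : X = L := by
  by_contra hne
  obtain ⟨C, hC, hXC⟩ := exists_covBy_of_lt (lt_of_le_of_ne hX hne)
  exact hC.lt.not_ge (h ▸ sup_le hXC (radOf_le_of_covBy hC))

lemma sup_eq_of_natLength {c d J : Submodule S M} (hc : IsAtom c) (hd : IsAtom d) (h : c ≠ d)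
    (hcJ : c ≤ J) (hdJ : d ≤ J) (hJ : natLength S J = 2) : c ⊔ d = J := by
  refine eq_of_natLength_le (sup_le hcJ hdJ) ?_
  have h1 := natLength_sup_add_inf c d
  rw [(hc.disjoint_of_ne hd h).eq_bot, natLength_bot, natLength_isAtom hc,
    natLength_isAtom hd] at h1
  omega

end Submodules

section LengthFive

variable {S : Type u} [Ring S] {M : Type u} [AddCommGroup M] [Module S M]
  [IsArtinian S M] [IsNoetherian S M]

lemma LongIndecLocal.exists_hom_of_radOf_eq_sup (hS : LongIndecLocal S) (hM : HasLocalTop S M)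
    (hlen : 4 ≤ natLength S M) {X : Submodule S M} (hX : HasLocalTop S X)
    (hXM : X ≤ Module.jacobson S M) {c d : Submodule S M} (hc : IsAtom c) (hd : IsAtom d)
    (hcd : c ≠ d) (h : radOf X = c ⊔ d) :
    ∃ h : X →ₗ[S] M, (∀ x : X, (x : M) ∈ c → h x = 0) ∧ ∀ x : X, (x : M) ∈ d → h x = x := by
  have hX' : c ⊔ d ≤ X := h ▸ Submodule.map_subtype_le _ _
  have hcX : c ≤ X := le_sup_left.trans hX'
  have hdX : d ≤ X := le_sup_right.trans hX'
  have hne : c.comap X.subtype ≠ d.comap X.subtype := fun h0 => by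
    have h1 := congrArg (Submodule.map X.subtype) h0
    rw [Submodule.map_comap_subtype, Submodule.map_comap_subtype, inf_eq_right.mpr hcX,
      inf_eq_right.mpr hdX] at h1
    exact hcd h1
  refine hS.exists_hom_of_jacobson_eq_sup hM hX hlen X.subtype_injective
    (X.range_subtype.trans_le hXM) (isAtom_comap_subtype hc hcX) (isAtom_comap_subtype hd hdX)
    hne ?_
  apply Submodule.map_injective_of_injective X.subtype_injective
  rw [Submodule.map_sup, Submodule.map_comap_subtype, Submodule.map_comap_subtype,
    inf_eq_right.mpr hcX, inf_eq_right.mpr hdX]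
  exact h

/-- The possible shapes of the radical of a local module which is not colocal. -/
def HasRadicalDecomposition (S M : Type*) [Ring S] [AddCommGroup M] [Module S M] : Prop :=
  ∃ S1 S2 : Submodule S M, IsAtom S1 ∧ IsAtom S2 ∧ S1 ≠ S2 ∧
    moduleSoc S M = S1 ⊔ S2 ∧
    Xor'
      (∃ N : Submodule S M, IsUniserialModule S ↑N ∧
        moduleLength S ↑N = (3 : ℕ) ∧ socOf N = S2 ∧ Disjoint N S1 ∧
        radPow S M 1 = N ⊔ S1)
      (∃ N1 N2 : Submodule S M, IsUniserialModule S ↑N1 ∧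
        IsUniserialModule S ↑N2 ∧ moduleLength S ↑N1 = (2 : ℕ) ∧
        moduleLength S ↑N2 = (2 : ℕ) ∧ socOf N1 = S1 ∧ socOf N2 = S2 ∧
        Disjoint N1 N2 ∧ radPow S M 1 = N1 ⊔ N2)

variable {J N : Submodule S M}

/-- If a simple submodule splits off the radical, the complement is local. -/
lemma unique_covBy_of_disjoint_isAtom {L T : Submodule S M} (hLJ : radOf L = J)
    (hJ : natLength S J = 2) (hN : natLength S N = 3) (hL : natLength S L = 4) (hT : IsAtom T)
    (hJN : J ≤ N) (hd : Disjoint N T) (hsup : N ⊔ T = L) {C : Submodule S M} (hC : C ⋖ N) :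
    C = J := by
  have lC := natLength_covBy hC
  have lCT := natLength_sup_add_inf C T
  rw [(hd.mono_left hC.le).eq_bot, natLength_bot, natLength_isAtom hT] at lCT
  have hCT : C ⊔ T ⋖ L := covBy_of_natLength (hsup ▸ sup_le_sup_right hC.le T) (by omega)
  have hJC : J ≤ C := by
    have h1 : J ≤ (C ⊔ T) ⊓ N := le_inf (hLJ ▸ radOf_le_of_covBy hCT) hJN
    rwa [sup_inf_assoc_of_le T hC.le, inf_comm T N, hd.eq_bot, sup_bot_eq] at h1
  exact (eq_of_natLength_le hJC (by omega)).symm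

lemma hasRadicalDecomposition_of_not_le (hS : LongIndecLocal S) (hM : HasLocalTop S M)
    (h5 : natLength S M = 5) (hJ : radOf (Module.jacobson S M) = J) (lJ : natLength S J = 2)
    (lN : natLength S N = 3) (hJN : J ≤ N) {T : Submodule S M} (hT : IsAtom T)
    (hTJ : ¬ T ≤ J) (hd : Disjoint N T) (hsup : N ⊔ T = Module.jacobson S M) :
    HasRadicalDecomposition S M := by
  have lL : natLength S (Module.jacobson S M) = 4 := by
    have := hM.natLength_eq
    omega
  have hcov : ∀ {C}, C ⋖ N → C = J := fun hC =>
    unique_covBy_of_disjoint_isAtom hJ lJ lN lL hT hJN hd hsup hC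
  have hN0 : N ≠ ⊥ := fun h0 => by
    rw [h0, natLength_bot] at lN
    omega
  have hNtop : HasLocalTop S N :=
    hasLocalTop_of_unique_covBy hN0 fun C D hC hD => (hcov hC).trans (hcov hD).symm
  have hNJ : radOf N = J := hcov (covBy_map_subtype hNtop.isCoatom)
  have hNL : N ≤ Module.jacobson S M := hsup ▸ le_sup_left
  have hJ0 : J ≠ ⊥ := fun h0 => by
    rw [h0, natLength_bot] at lJ
    omega
  obtain ⟨c, hcJ, hc⟩ := exists_isAtom_le hJ0
  by_cases hu : ∃ d ≤ J, IsAtom d ∧ c ≠ d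
  · exfalso
    obtain ⟨d, hdJ, hd', hcd⟩ := hu
    have hJcd := sup_eq_of_natLength hc hd' hcd hcJ hdJ lJ
    obtain ⟨h, hhc, hhd⟩ := hS.exists_hom_of_radOf_eq_sup hM (by omega) hNtop hNL hc hd' hcd
      (hNJ.trans hJcd.symm)
    have hr : ∀ y, (T.mkQ ∘ₗ h) y ∈ LinearMap.range (T.mkQ ∘ₗ N.subtype) := fun y => by
      have h1 : h y ∈ N ⊔ T := by
        rw [hsup]
        refine hM.range_le (fun hs => ?_) ⟨y, rfl⟩
        have := natLength_range_add_ker h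
        rw [LinearMap.range_eq_top.mpr hs, natLength_top] at this
        omega
      obtain ⟨n, hn, t, ht, hnt⟩ := Submodule.mem_sup.mp h1
      refine ⟨⟨n, hn⟩, ?_⟩
      rw [LinearMap.comp_apply, LinearMap.comp_apply, ← hnt, map_add,
        show T.mkQ t = 0 from (Submodule.Quotient.mk_eq_zero T).mpr ht, add_zero]
      rfl
    have hι := mkQ_comp_subtype_injective hd.symm
    obtain ⟨g, hg⟩ := exists_factor hι hr
    obtain ⟨x, hx, hx0⟩ := (Submodule.ne_bot_iff _).mp hc.1
    obtain ⟨y, hy, hy0⟩ := (Submodule.ne_bot_iff _).mp hd'.1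
    refine hNtop.false_of_endomorphism (g := g) (x := ⟨x, hJN (hcJ hx)⟩)
      (y := ⟨y, hJN (hdJ hy)⟩) ?_ (fun h0 => hx0 (congrArg Subtype.val h0)) (hι ?_)
      (fun h0 => hy0 (congrArg Subtype.val h0)) ?_ (hι ?_)
    · have h1 : Module.jacobson S J = ⊥ := hJcd ▸ jacobson_sup_isAtom hc hd' hcd
      have hle : ∀ x ∈ Module.jacobson S N, N.subtype x ∈ J := fun x hx => hNJ ▸ ⟨x, hx, rfl⟩
      refine Module.jacobson_eq_bot_of_injective (N.subtype.restrict hle) (fun a b hab => ?_) h1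
      have h2 := congrArg Subtype.val hab
      exact Subtype.ext (Subtype.ext h2)
    · rw [hg, map_zero, LinearMap.comp_apply, hhc _ hx, map_zero]
    · have h1 : y ∈ radOf N := hNJ ▸ hdJ hy
      obtain ⟨z, hz, hzy⟩ := h1
      rwa [← Subtype.ext (a1 := z) (a2 := ⟨y, hJN (hdJ hy)⟩) hzy]
    · rw [hg, LinearMap.comp_apply, hhd _ hy]
      rfl
  · have huniq : ∀ d ≤ J, IsAtom d → d = c := fun d hdJ hd' => by
      by_contra hne
      exact hu ⟨d, hdJ, hd', Ne.symm hne⟩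
    have hlist : ∀ X ≤ N, X = ⊥ ∨ X = c ∨ X = J ∨ X = N := by
      intro X hX
      rcases hX.lt_or_eq with hlt | rfl
      · obtain ⟨C, hC, hXC⟩ := exists_covBy_of_lt hlt
        rw [hcov hC] at hXC
        rcases hXC.lt_or_eq with hlt' | rfl
        · by_cases hX0 : X = ⊥
          · exact Or.inl hX0
          · obtain ⟨d, hdX, hd'⟩ := exists_isAtom_le hX0
            have h1 := huniq d (hdX.trans hXC) hd'
            have h2 := natLength_lt hlt'
            have h3 := natLength_isAtom hd'
            exact Or.inr (Or.inl (h1 ▸ (eq_of_natLength_le hdX (by omega)).symm))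
        · simp
      · simp
    have hatom : ∀ X, IsAtom X → X ≤ N → X = c := by
      intro X hX hXN
      have h1 := natLength_isAtom hX
      rcases hlist X hXN with rfl | rfl | rfl | rfl
      · exact absurd rfl hX.1
      · rfl
      · omega
      · omega
    have hTc : T ≠ c := fun h0 => hTJ (h0 ▸ hcJ)
    have hTL := le_jacobson_of_isAtom hM h5 hT
    refine ⟨T, c, hT, hc, hTc, le_antisymm (sSup_le fun X hX => ?_)
      (sup_le (le_sSup hT) (le_sSup hc)), Or.inl ⟨⟨N, ?_, ?_, ?_, hd, ?_⟩, ?_⟩⟩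
    · by_cases hXT : X = T
      · exact hXT ▸ le_sup_left
      have l1 := natLength_sup_of_isAtom hX hT hXT
      have h1 : X ⊔ T ⊔ N = Module.jacobson S M :=
        le_antisymm (sup_le (sup_le (le_jacobson_of_isAtom hM h5 hX) hTL) hNL)
          (hsup ▸ sup_le le_sup_right (le_sup_right.trans le_sup_left))
      have l2 := natLength_sup_add_inf (X ⊔ T) N
      rw [h1] at l2
      have h2 := hatom _ (isAtom_of_natLength (by omega : natLength S ↥((X ⊔ T) ⊓ N) = 1))
        inf_le_right
      have h3 : c ≤ X ⊔ T := h2 ▸ inf_le_left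
      rw [sup_eq_of_natLength hT hc hTc le_sup_right h3 l1]
      exact le_sup_left
    · refine isUniserialModule_of_le fun A B hA hB => ?_
      have hcN := hcJ.trans hJN
      rcases hlist A hA with rfl | rfl | rfl | rfl
      · exact Or.inl bot_le
      · rcases hlist B hB with rfl | rfl | rfl | rfl
        · exact Or.inr bot_le
        · exact Or.inl le_rfl
        · exact Or.inl hcJ
        · exact Or.inl hcN
      · rcases hlist B hB with rfl | rfl | rfl | rfl
        · exact Or.inr bot_le
        · exact Or.inr hcJ
        · exact Or.inl le_rfl
        · exact Or.inl hJN
      · exact Or.inr hB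
    · rw [moduleLength_eq_natLength, lN]
    · exact socOf_eq_of_isAtom hc (hcJ.trans hJN) hatom
    · rw [radPow_one, hsup]
    · rintro ⟨N1, N2, hN1, -, l1, -, hs, -, -, hN⟩
      rw [moduleLength_eq_natLength] at l1
      have l1' : natLength S N1 = 2 := by exact_mod_cast l1
      have hTN : T ≤ N1 := hs ▸ Submodule.map_subtype_le _ _
      have h1 : T ≤ radOf N1 := le_radOf_of_covBy hTN fun D hD => by
        have lD := natLength_covBy hD
        have lT := natLength_isAtom hT
        rcases hN1.le_total_of_le hTN hD.le with h | h
        · exact h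
        · exact (eq_of_natLength_le h (by omega)).ge
      rw [radPow_one] at hN
      exact hTJ (hJ ▸ h1.trans (radOf_mono (hN ▸ le_sup_left)))

end LengthFive

section NoSplitting

variable {S : Type u} [Ring S] {M : Type u} [AddCommGroup M] [Module S M]

/-- The quotient of a local module by the radical of its radical has semisimple radical. -/
lemma HasLocalTop.isLocalSemisimpleRad_quotient (hM : HasLocalTop S M) :
    IsLocalSemisimpleRad S (M ⧸ radOf (Module.jacobson S M)) := by
  have hle : radOf (Module.jacobson S M) ≤ Module.jacobson S M := Submodule.map_subtype_le _ _
  obtain ⟨h1, h2⟩ := hM.quotient (P := radOf (Module.jacobson S M)) fun h0 =>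
    hM.1 (top_le_iff.mp (h0 ▸ hle))
  refine ⟨h1, ?_⟩
  have hmem : ∀ x ∈ Module.jacobson S M, (radOf (Module.jacobson S M)).mkQ x ∈
      Module.jacobson S (M ⧸ radOf (Module.jacobson S M)) := fun x hx => h2 ▸ ⟨x, hx, rfl⟩
  let f := (radOf (Module.jacobson S M)).mkQ.restrict hmem
  have hf0 : ∀ x : Module.jacobson S M, f x = 0 ↔ (x : M) ∈ radOf (Module.jacobson S M) :=
    fun x => Subtype.ext_iff.trans (Submodule.Quotient.mk_eq_zero _)
  have hfs : Function.Surjective f := fun ⟨y, hy⟩ => by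
    rw [h2] at hy
    obtain ⟨x, hx, rfl⟩ := hy
    exact ⟨⟨x, hx⟩, rfl⟩
  have hker : LinearMap.ker f ≤ Module.jacobson S (Module.jacobson S M) := fun x hx => by
    obtain ⟨z, hz, hzx⟩ := (hf0 x).mp hx
    rwa [← Subtype.ext (a1 := z) (a2 := x) hzx]
  rw [← Module.map_jacobson_of_ker_le hfs hker, ← le_bot_iff, Submodule.map_le_iff_le_comap]
  exact fun x hx => (Submodule.mem_bot S).mpr ((hf0 x).mpr ⟨x, hx, rfl⟩)

variable [IsArtinian S M]

lemma exists_isAtom_ne_of_not_isColocalModule [Nontrivial M] (h : ¬ IsColocalModule S M) :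
    ∃ c d : Submodule S M, IsAtom c ∧ IsAtom d ∧ c ≠ d := by
  obtain ⟨c, -, hc⟩ := exists_isAtom_le (top_ne_bot : (⊤ : Submodule S M) ≠ ⊥)
  by_contra! hno
  refine h ?_
  have : moduleSoc S M = c :=
    le_antisymm (sSup_le fun T hT => (hno T c hT hc).le) (le_sSup hc)
  rwa [IsColocalModule, this]

lemma disjoint_of_unique_isAtom {N1 N2 c d : Submodule S M} (h1 : ∀ T, IsAtom T → T ≤ N1 → T = c)
    (h2 : ∀ T, IsAtom T → T ≤ N2 → T = d) (hcd : c ≠ d) : Disjoint N1 N2 := by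
  rw [disjoint_iff]
  by_contra hne
  obtain ⟨T, hT, hT'⟩ := exists_isAtom_le hne
  exact hcd ((h1 T hT' (hT.trans inf_le_left)).symm.trans (h2 T hT' (hT.trans inf_le_right)))

variable [IsNoetherian S M]

lemma LongIndecLocal.exists_uniserial_of_radOf_eq_sup (hS : LongIndecLocal S)
    (hM : HasLocalTop S M) (h5 : natLength S M = 5) {X : Submodule S M} (hX : HasLocalTop S X)
    (hXM : X ≤ Module.jacobson S M) {c d : Submodule S M} (hc : IsAtom c) (hd : IsAtom d)
    (hcd : c ≠ d) (h : radOf X = c ⊔ d) :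
    ∃ N ≤ Module.jacobson S M, natLength S N = 2 ∧ IsUniserialModule S N ∧ d ≤ N := by
  obtain ⟨f, hfc, hfd⟩ := hS.exists_hom_of_radOf_eq_sup hM (by omega) hX hXM hc hd hcd h
  have hX' : c ⊔ d ≤ X := h ▸ Submodule.map_subtype_le _ _
  have hdN : d ≤ LinearMap.range f := fun y hy =>
    ⟨⟨y, hX' (le_sup_right (a := c) hy)⟩, hfd _ hy⟩
  obtain ⟨y, hy, hy0⟩ := (Submodule.ne_bot_iff _).mp hd.1
  have hyX : y ∈ X := hX' (le_sup_right (a := c) hy)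
  have hyf : f ⟨y, hyX⟩ ≠ 0 := (hfd ⟨y, hyX⟩ hy).trans_ne hy0
  have lJ : natLength S (Module.jacobson S X) = 2 := by
    have h1 := natLength_map_subtype (Module.jacobson S X)
    have h2 := natLength_sup_of_isAtom hc hd hcd
    rw [← h] at h2
    exact h1.symm.trans h2
  have lX := hX.natLength_eq
  have hyJ : (⟨y, hyX⟩ : X) ∈ Module.jacobson S X := by
    have h1 : y ∈ radOf X := h ▸ le_sup_right (a := c) hy
    obtain ⟨z, hz, hzy⟩ := h1
    rwa [← Subtype.ext (a1 := z) (a2 := ⟨y, hyX⟩) hzy]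
  have l1 : natLength S (LinearMap.ker f) < 2 := by
    rw [← lJ]
    refine natLength_lt (lt_of_le_of_ne (hX.2 _ fun h0 => hyf ?_) fun h0 => hyf ?_)
    · exact LinearMap.mem_ker.mp (h0 ▸ Submodule.mem_top)
    · exact LinearMap.mem_ker.mp (h0 ▸ hyJ)
  have l2 : natLength S (c.comap X.subtype) ≤ natLength S (LinearMap.ker f) :=
    natLength_le fun x hx => hfc x hx
  rw [natLength_comap_subtype (le_sup_left.trans hX'), natLength_isAtom hc] at l2
  have l3 := natLength_range_add_ker f
  have lN : natLength S (LinearMap.range f) = 2 := by omega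
  have : Nontrivial (LinearMap.range f) :=
    ⟨⟨⟨y, hdN hy⟩, 0, fun h0 => hy0 (congrArg Subtype.val h0)⟩⟩
  refine ⟨LinearMap.range f, hM.range_le fun hs => ?_, lN,
    (hX.map_surjective f.surjective_rangeRestrict).1.isUniserialModule lN, hdN⟩
  rw [LinearMap.range_eq_top.mpr hs, natLength_top] at lN
  omega

/-- A submodule minimal among those contained in `A` but not in `B` is local. -/
lemma exists_hasLocalTop_le {A B : Submodule S M} (h : ¬ A ≤ B) :
    ∃ Y ≤ A, ¬ Y ≤ B ∧ HasLocalTop S Y ∧ radOf Y = Y ⊓ B := by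
  obtain ⟨Y, ⟨hYA, hYB⟩, hmin⟩ :=
    wellFounded_lt.has_min {X : Submodule S M | X ≤ A ∧ ¬ X ≤ B} ⟨A, le_rfl, h⟩
  have hcov : ∀ C, C ⋖ Y → C = Y ⊓ B := fun C hC => by
    have hCB : C ≤ B := by
      by_contra hCB
      exact hmin C ⟨hC.le.trans hYA, hCB⟩ hC.lt
    refine ((hC.eq_or_eq (le_inf hC.le hCB) inf_le_left).resolve_right fun h0 => ?_).symm
    exact hYB (h0 ▸ inf_le_right)
  have hY0 : Y ≠ ⊥ := fun h0 => hYB (h0 ▸ bot_le)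
  have hY := hasLocalTop_of_unique_covBy hY0 fun C D hC hD => (hcov C hC).trans (hcov D hD).symm
  exact ⟨Y, hYA, hYB, hY, hcov _ (covBy_map_subtype hY.isCoatom)⟩

lemma natLength_sup_of_disjoint {N1 N2 : Submodule S M} (h : Disjoint N1 N2) :
    natLength S ↥(N1 ⊔ N2) = natLength S N1 + natLength S N2 := by
  have := natLength_sup_add_inf N1 N2
  rwa [h.eq_bot, natLength_bot, add_zero] at this

variable {J L : Submodule S M}

lemma LongIndecLocal.exists_two_uniserial_of_hasLocalTop (hS : LongIndecLocal S)
    (hM : HasLocalTop S M) (h5 : natLength S M = 5) {X : Submodule S M} (hX : HasLocalTop S X)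
    (hXM : X ≤ Module.jacobson S M) {c d : Submodule S M} (hc : IsAtom c) (hd : IsAtom d)
    (hcd : c ≠ d) (h : radOf X = c ⊔ d) :
    ∃ N1 N2 : Submodule S M, natLength S N1 = 2 ∧ natLength S N2 = 2 ∧
      IsUniserialModule S N1 ∧ IsUniserialModule S N2 ∧ Disjoint N1 N2 ∧
      N1 ⊔ N2 = Module.jacobson S M := by
  obtain ⟨N1, hN1, l1, u1, hd1⟩ := hS.exists_uniserial_of_radOf_eq_sup hM h5 hX hXM hc hd hcd h
  obtain ⟨N2, hN2, l2, u2, hc2⟩ := hS.exists_uniserial_of_radOf_eq_sup hM h5 hX hXM hd hc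
    hcd.symm (h.trans (sup_comm c d))
  have hdisj := disjoint_of_unique_isAtom (fun T hT h => u1.eq_of_isAtom h hd1 hT hd)
    (fun T hT h => u2.eq_of_isAtom h hc2 hT hc) hcd.symm
  refine ⟨N1, N2, l1, l2, u1, u2, hdisj, eq_of_natLength_le (sup_le hN1 hN2) ?_⟩
  have := hM.natLength_eq
  rw [natLength_sup_of_disjoint hdisj]
  omega

lemma LongIndecLocal.exists_two_uniserial (hS : LongIndecLocal S)
    (hM : HasLocalTop S M) (h5 : natLength S M = 5) {C1 C2 : Submodule S M}
    (hC1 : C1 ⋖ Module.jacobson S M) (hC2 : C2 ⋖ Module.jacobson S M) (hne : C1 ≠ C2)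
    (hJ : radOf (Module.jacobson S M) = J) (hJC : C1 ⊓ C2 = J) (lJ : natLength S J = 2)
    {c d : Submodule S M} (hc : IsAtom c) (hd : IsAtom d) (hcd : c ≠ d)
    (hatom : ∀ T : Submodule S M, IsAtom T → T ≤ J) :
    ∃ N1 N2 : Submodule S M, natLength S N1 = 2 ∧ natLength S N2 = 2 ∧
      IsUniserialModule S N1 ∧ IsUniserialModule S N2 ∧ Disjoint N1 N2 ∧
      N1 ⊔ N2 = Module.jacobson S M := by
  have lM := hM.natLength_eq
  have l1 := natLength_covBy hC1
  have l2 := natLength_covBy hC2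
  have hn12 : ¬ C1 ≤ C2 := fun h => hne (eq_of_natLength_le h (by omega))
  have hn21 : ¬ C2 ≤ C1 := fun h => hne (eq_of_natLength_le h (by omega)).symm
  have hcdJ := sup_eq_of_natLength hc hd hcd (hatom c hc) (hatom d hd) lJ
  have key : ∀ {A B Y : Submodule S M}, A ⊓ B = J → natLength S A = 3 → Y ≤ A → ¬ Y ≤ B →
      HasLocalTop S Y → radOf Y = Y ⊓ B → Y ⊔ J = A ∧ (radOf Y = J ∨ natLength S Y = 2) := by
    intro A B Y hAB lA hYA hYB hY hYr
    have hYJ : ¬ Y ≤ J := fun h => hYB (h.trans (hAB ▸ inf_le_right))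
    have hJA : J ≤ A := hAB ▸ inf_le_left
    have hYr' : radOf Y = Y ⊓ J := by
      rw [hYr, ← hAB, ← inf_assoc, inf_eq_left.mpr hYA]
    refine ⟨?_, ?_⟩
    · rw [sup_comm]
      exact sup_eq_of_covBy (covBy_of_natLength hJA (by omega)) hYA hYJ
    · by_cases hJY : J ≤ Y
      · exact Or.inl (hYr'.trans (inf_eq_right.mpr hJY))
      · right
        have l3 := natLength_covBy (covBy_map_subtype hY.isCoatom)
        have l4 : natLength S ↥(Y ⊓ J) < natLength S J :=
          natLength_lt (lt_of_le_of_ne inf_le_right fun h => hJY (h ▸ inf_le_left))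
        have l5 : natLength S Y = natLength S ↥(Y ⊓ J) + 1 := hYr' ▸ l3
        have l6 : natLength S Y ≠ 1 := fun h => hYJ (hatom Y (isAtom_of_natLength h))
        omega
  obtain ⟨Y1, hY1, hY1', hY1t, hY1r⟩ := exists_hasLocalTop_le hn12
  obtain ⟨Y2, hY2, hY2', hY2t, hY2r⟩ := exists_hasLocalTop_le hn21
  obtain ⟨hs1, h1 | k1⟩ := key hJC (by omega) hY1 hY1' hY1t hY1r
  · exact hS.exists_two_uniserial_of_hasLocalTop hM h5 hY1t (hY1.trans hC1.le) hc hd hcd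
      (h1.trans hcdJ.symm)
  obtain ⟨hs2, h2 | k2⟩ := key (inf_comm C1 C2 ▸ hJC) (by omega) hY2 hY2' hY2t hY2r
  · exact hS.exists_two_uniserial_of_hasLocalTop hM h5 hY2t (hY2.trans hC2.le) hc hd hcd
      (h2.trans hcdJ.symm)
  have hle : Y1 ⊔ Y2 ≤ Module.jacobson S M :=
    sup_le (hY1.trans hC1.le) (hY2.trans hC2.le)
  have hsup : Y1 ⊔ Y2 = Module.jacobson S M := by
    refine eq_of_sup_radOf_eq hle (le_antisymm (sup_le hle (Submodule.map_subtype_le _ _)) ?_)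
    rw [hJ, ← sup_eq_of_covBy hC1 hC2.le hn21, ← hs1, ← hs2]
    exact sup_le (sup_le_sup_right le_sup_left J) (sup_le_sup_right le_sup_right J)
  refine ⟨Y1, Y2, k1, k2, hY1t.isUniserialModule k1, hY2t.isUniserialModule k2, ?_, hsup⟩
  have l3 := natLength_sup_add_inf Y1 Y2
  rw [hsup] at l3
  have l4 : natLength S ↥(Y1 ⊓ Y2) = 0 := by omega
  rw [disjoint_iff]
  by_contra h0
  obtain ⟨T, hT, hT'⟩ := exists_isAtom_le h0
  have := natLength_le hT
  rw [natLength_isAtom hT'] at this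
  omega

lemma hasRadicalDecomposition_of_forall_le (hS : LongIndecLocal S) (hM : HasLocalTop S M)
    (h5 : natLength S M = 5) {C1 C2 : Submodule S M}
    (hC1 : C1 ⋖ Module.jacobson S M) (hC2 : C2 ⋖ Module.jacobson S M) (hne : C1 ≠ C2)
    (hJ : radOf (Module.jacobson S M) = J) (hJC : C1 ⊓ C2 = J) (lJ : natLength S J = 2)
    {c d : Submodule S M} (hc : IsAtom c) (hd : IsAtom d) (hcd : c ≠ d)
    (hatom : ∀ T : Submodule S M, IsAtom T → T ≤ J) : HasRadicalDecomposition S M := by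
  obtain ⟨N1, N2, l1, l2, u1, u2, hdisj, hsup⟩ :=
    hS.exists_two_uniserial hM h5 hC1 hC2 hne hJ hJC lJ hc hd hcd hatom
  have hbot : ∀ {N : Submodule S M}, natLength S N = 2 → N ≠ ⊥ := fun l h0 => by
    rw [h0, natLength_bot] at l
    omega
  obtain ⟨S1, hS1, a1, s1⟩ := u1.exists_socOf_eq (hbot l1)
  obtain ⟨S2, hS2, a2, s2⟩ := u2.exists_socOf_eq (hbot l2)
  have hne' : S1 ≠ S2 := fun h0 => a1.1 (le_bot_iff.mp (hdisj hS1 (h0 ▸ hS2)))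
  have hJS := sup_eq_of_natLength a1 a2 hne' (hatom _ a1) (hatom _ a2) lJ
  refine ⟨S1, S2, a1, a2, hne', le_antisymm (sSup_le fun T hT => hJS ▸ hatom T hT)
    (sup_le (le_sSup a1) (le_sSup a2)), Or.inr ⟨⟨N1, N2, u1, u2, ?_, ?_, s1, s2, hdisj, ?_⟩, ?_⟩⟩
  · rw [moduleLength_eq_natLength, l1]
  · rw [moduleLength_eq_natLength, l2]
  · rw [radPow_one, hsup]
  · rintro ⟨N, -, -, -, hd', hN⟩
    rw [radPow_one] at hN
    have hNL : N ≤ Module.jacobson S M := hN ▸ le_sup_left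
    have h1 : N = Module.jacobson S M := by
      refine eq_of_sup_radOf_eq hNL
        (le_antisymm (sup_le hNL (Submodule.map_subtype_le _ _)) ?_)
      rw [hJ]
      exact hN.le.trans (sup_le_sup_left (hatom _ a1) N)
    exact a1.1 (le_bot_iff.mp (hd' (h1 ▸ hN ▸ le_sup_right) le_rfl))

end NoSplitting

lemma hasRadicalDecomposition {R : Type*} [CommRing R] [IsArtinianRing R] {S : Type u} [Ring S]
    [Algebra R S] [Module.Finite R S] [IsArtinianRing S] (hFB : FactorSerialBound S)
    {M : Type u} [AddCommGroup M] [Module S M] [Module.Finite S M] (hM : HasLocalTop S M)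
    (h5 : natLength S M = 5) (hfs : IsNFactorSerial S M 4) (hncoloc : ¬ IsColocalModule S M) :
    HasRadicalDecomposition S M := by
  have hS := hFB.longIndecLocal
  obtain ⟨-, -, l, hl, -, hu, hu'⟩ := hfs
  obtain rfl : l = 5 := (natLength_eq_of_moduleLength hl).symm.trans h5
  obtain ⟨C1, C2, hC1, hC2, hne⟩ := exists_two_covBy_radPow hu hu'
  have hr : radPow S M (5 - 4) = Module.jacobson S M := radPow_one
  rw [hr] at hC1 hC2
  have lM := hM.natLength_eq
  have l1 := natLength_covBy hC1
  have l2 := natLength_covBy hC2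
  have l12 := natLength_sup_add_inf C1 C2
  rw [sup_eq_of_covBy hC1 hC2.le fun h => hne (eq_of_natLength_le h (by omega)).symm] at l12
  have hlq := hS.natLength_le_three (R := R) hFB.natLength_le_five
    hM.isLocalSemisimpleRad_quotient
  have hlq' := natLength_add_quotient (radOf (Module.jacobson S M))
  have hJC : C1 ⊓ C2 = radOf (Module.jacobson S M) := (eq_of_natLength_le
    (le_inf (radOf_le_of_covBy hC1) (radOf_le_of_covBy hC2)) (by omega)).symm
  have lJ : natLength S (radOf (Module.jacobson S M)) = 2 := by
    rw [← hJC]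
    omega
  have : Nontrivial M := by
    by_contra h
    rw [not_nontrivial_iff_subsingleton] at h
    exact hM.1 (Subsingleton.elim _ _)
  obtain ⟨c, d, hc, hd, hcd⟩ := exists_isAtom_ne_of_not_isColocalModule hncoloc
  by_cases hatom : ∀ T : Submodule S M, IsAtom T → T ≤ radOf (Module.jacobson S M)
  · exact hasRadicalDecomposition_of_forall_le hS hM h5 hC1 hC2 hne rfl hJC lJ hc hd hcd hatom
  · push Not at hatom
    obtain ⟨T, hT, hTJ⟩ := hatom
    obtain ⟨N, hN, hTN⟩ : ∃ N, N ⋖ Module.jacobson S M ∧ ¬ T ≤ N := by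
      by_cases h : T ≤ C1
      · exact ⟨C2, hC2, fun h' => hTJ (hJC ▸ le_inf h h')⟩
      · exact ⟨C1, hC1, h⟩
    have lN := natLength_covBy hN
    exact hasRadicalDecomposition_of_not_le hS hM h5 rfl lJ (by omega) (radOf_le_of_covBy hN) hT
      hTJ (hT.not_le_iff_disjoint.mp hTN).symm
      (sup_eq_of_covBy hN (le_jacobson_of_isAtom hM h5 hT) hTN)

theorem radical_of_local_noncolocal_four_factor_serial
    (R : Type*) [CommRing R] [IsArtinianRing R]
    (Λ : Type u) [Ring Λ] [Algebra R Λ] [Module.Finite R Λ]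
    (hΛ : IsRightNNakayama Λ 4)
    (M : Type u) [AddCommGroup M] [Module Λᵐᵒᵖ M] [Module.Finite Λᵐᵒᵖ M]
    (hind : IsIndecModule Λᵐᵒᵖ M) (hfs : IsNFactorSerial Λᵐᵒᵖ M 4)
    (hloc : IsLocalModule Λᵐᵒᵖ M) (hncoloc : ¬ IsColocalModule Λᵐᵒᵖ M) :
    moduleLength Λᵐᵒᵖ M = (5 : ℕ) ∧
    ∃ S1 S2 : Submodule Λᵐᵒᵖ M, IsAtom S1 ∧ IsAtom S2 ∧ S1 ≠ S2 ∧
      moduleSoc Λᵐᵒᵖ M = S1 ⊔ S2 ∧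
      Xor'
        (∃ N : Submodule Λᵐᵒᵖ M, IsUniserialModule Λᵐᵒᵖ ↑N ∧
          moduleLength Λᵐᵒᵖ ↑N = (3 : ℕ) ∧ socOf N = S2 ∧ Disjoint N S1 ∧
          radPow Λᵐᵒᵖ M 1 = N ⊔ S1)
        (∃ N1 N2 : Submodule Λᵐᵒᵖ M, IsUniserialModule Λᵐᵒᵖ ↑N1 ∧
          IsUniserialModule Λᵐᵒᵖ ↑N2 ∧ moduleLength Λᵐᵒᵖ ↑N1 = (2 : ℕ) ∧
          moduleLength Λᵐᵒᵖ ↑N2 = (2 : ℕ) ∧ socOf N1 = S1 ∧ socOf N2 = S2 ∧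
          Disjoint N1 N2 ∧ radPow Λᵐᵒᵖ M 1 = N1 ⊔ N2) := by
  have : Module.Finite R Λᵐᵒᵖ := Module.Finite.equiv (MulOpposite.opLinearEquiv R)
  have : IsArtinianRing Λᵐᵒᵖ := IsArtinianRing.of_finite R _
  have hFB := hΛ.factorSerialBound
  have hM := hasLocalTop_of_isLocalModule hloc
  have h5 := hFB.longIndecLocal.natLength_eq_five hM hfs
  exact ⟨by rw [moduleLength_eq_natLength, h5],
    hasRadicalDecomposition (R := R) hFB hM h5 hfs hncoloc⟩
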